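/- Fix a tidy (H,𝒫)-graph G with m = |𝒫| in which every path P ∈ 𝒫 has at least 8m vertices. If G' is a G-tidy trigraph whose part H' consists of a single vertex, then G' admits a contraction sequence of width at most 4. -/

import Mathlib

attribute [local instance] Classical.propDecidable

open Finset

universe u

/-- A trigraph: a finite graph whose edge set is partitioned into black and red edges. -/
structure Trigraph (V : Type u) where
  verts : Finset V
  black : Finset (Sym2 V)
  red : Finset (Sym2 V)
  black_nodiag : ∀ e ∈ black, ¬ e.IsDiag
  red_nodiag : ∀ e ∈ red, ¬ e.IsDiag
  black_support : ∀ e ∈ black, ∀ x ∈ e, x ∈ verts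
  red_support : ∀ e ∈ red, ∀ x ∈ e, x ∈ verts
  disj : Disjoint black red

namespace Trigraph

variable {V : Type u}

def BlackAdj (G : Trigraph V) (x y : V) : Prop := s(x, y) ∈ G.black
def RedAdj (G : Trigraph V) (x y : V) : Prop := s(x, y) ∈ G.red
def Adj (G : Trigraph V) (x y : V) : Prop := G.BlackAdj x y ∨ G.RedAdj x y

noncomputable def redDeg (G : Trigraph V) (x : V) : ℕ := (G.red.filter (fun e => x ∈ e)).card
noncomputable def blackDeg (G : Trigraph V) (x : V) : ℕ := (G.black.filter (fun e => x ∈ e)).card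
noncomputable def deg (G : Trigraph V) (x : V) : ℕ :=
  ((G.black ∪ G.red).filter (fun e => x ∈ e)).card
noncomputable def maxRedDeg (G : Trigraph V) : ℕ := G.verts.sup G.redDeg

/-- The black edges after contracting `v` into `u`. -/
noncomputable def cBlack (G : Trigraph V) (u v : V) : Finset (Sym2 V) :=
  G.black.filter (fun e => u ∉ e ∧ v ∉ e) ∪
    ((G.verts.erase v).filter
      (fun y => y ≠ u ∧ s(u, y) ∈ G.black ∧ s(v, y) ∈ G.black)).image (fun y => s(u, y))

/-- The red edges after contracting `v` into `u`. -/
noncomputable def cRed (G : Trigraph V) (u v : V) : Finset (Sym2 V) :=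
  G.red.filter (fun e => u ∉ e ∧ v ∉ e) ∪
    ((G.verts.erase v).filter
      (fun y => y ≠ u ∧ ¬(s(u, y) ∈ G.black ∧ s(v, y) ∈ G.black) ∧
        (s(u, y) ∈ G.red ∨ s(v, y) ∈ G.red ∨
          ¬((s(u, y) ∈ G.black) ↔ (s(v, y) ∈ G.black))))).image (fun y => s(u, y))

/-- Contraction of the two distinct vertices `u, v` of `G`: `v` is removed, `u` becomes the
new merged vertex; a black edge survives towards a common black neighbor, and a red edge is
created towards any other remaining neighbor of `u` or `v`. If `u = v` or one of them is not a
vertex, `G` is returned unchanged. -/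
noncomputable def contract (G : Trigraph V) (u v : V) : Trigraph V :=
  if h : u ≠ v ∧ u ∈ G.verts ∧ v ∈ G.verts then
    { verts := G.verts.erase v
      black := cBlack G u v
      red := cRed G u v
      black_nodiag := by
        intro e he
        rcases Finset.mem_union.1 he with he | he
        · exact G.black_nodiag e (Finset.mem_filter.1 he).1
        · obtain ⟨y, hy, rfl⟩ := Finset.mem_image.1 he
          have hyu : y ≠ u := ((Finset.mem_filter.1 hy).2).1
          simpa [Sym2.isDiag_iff_proj_eq] using fun hh => hyu (Eq.symm hh)
      red_nodiag := by
        intro e he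
        rcases Finset.mem_union.1 he with he | he
        · exact G.red_nodiag e (Finset.mem_filter.1 he).1
        · obtain ⟨y, hy, rfl⟩ := Finset.mem_image.1 he
          have hyu : y ≠ u := ((Finset.mem_filter.1 hy).2).1
          simpa [Sym2.isDiag_iff_proj_eq] using fun hh => hyu (Eq.symm hh)
      black_support := by
        intro e he x hx
        rcases Finset.mem_union.1 he with he | he
        · rcases Finset.mem_filter.1 he with ⟨heb, hu, hv⟩
          refine Finset.mem_erase.2 ⟨?_, G.black_support e heb x hx⟩
          rintro rfl; exact hv hx
        · obtain ⟨y, hy, rfl⟩ := Finset.mem_image.1 he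
          rcases Sym2.mem_iff.1 hx with rfl | rfl
          · exact Finset.mem_erase.2 ⟨h.1.symm ∘ Eq.symm, h.2.1⟩
          · exact (Finset.mem_filter.1 hy).1
      red_support := by
        intro e he x hx
        rcases Finset.mem_union.1 he with he | he
        · rcases Finset.mem_filter.1 he with ⟨heb, hu, hv⟩
          refine Finset.mem_erase.2 ⟨?_, G.red_support e heb x hx⟩
          rintro rfl; exact hv hx
        · obtain ⟨y, hy, rfl⟩ := Finset.mem_image.1 he
          rcases Sym2.mem_iff.1 hx with rfl | rfl
          · exact Finset.mem_erase.2 ⟨h.1.symm ∘ Eq.symm, h.2.1⟩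
          · exact (Finset.mem_filter.1 hy).1
      disj := by
        rw [Finset.disjoint_left]
        intro e heb her
        rcases Finset.mem_union.1 heb with heb | heb <;>
          rcases Finset.mem_union.1 her with her | her
        · exact Finset.disjoint_left.1 G.disj (Finset.mem_filter.1 heb).1
            (Finset.mem_filter.1 her).1
        · obtain ⟨y, hy, hey⟩ := Finset.mem_image.1 her
          exact ((Finset.mem_filter.1 heb).2).1 (hey ▸ Sym2.mem_mk_left u y)
        · obtain ⟨y, hy, hey⟩ := Finset.mem_image.1 heb
          exact ((Finset.mem_filter.1 her).2).1 (hey ▸ Sym2.mem_mk_left u y)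
        · obtain ⟨y, hy, hey⟩ := Finset.mem_image.1 heb
          obtain ⟨y', hy', hey'⟩ := Finset.mem_image.1 her
          have : y = y' := Sym2.congr_right.1 (hey.trans hey'.symm)
          subst this
          exact (((Finset.mem_filter.1 hy').2).2).1 ((Finset.mem_filter.1 hy).2).2 }
  else G

/-- The trigraph obtained from `G` by performing the contractions recorded in `ps`
(each pair `(u, v)` contracts `v` into `u`). -/
noncomputable def stage (G : Trigraph V) (ps : List (V × V)) : Trigraph V :=
  ps.foldl (fun H p => H.contract p.1 p.2) G

/-- The list `ps` records genuine contractions (distinct current vertices) starting from `G`. -/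
noncomputable def ValidSteps : Trigraph V → List (V × V) → Prop
  | _, [] => True
  | G, p :: ps =>
      p.1 ≠ p.2 ∧ p.1 ∈ G.verts ∧ p.2 ∈ G.verts ∧ ValidSteps (G.contract p.1 p.2) ps

/-- `ps` encodes a (complete) contraction sequence of `G`, ending in a one-vertex trigraph. -/
noncomputable def IsContractionSeq (G : Trigraph V) (ps : List (V × V)) : Prop :=
  ValidSteps G ps ∧ (stage G ps).verts.card = 1

/-- The width of the (partial) contraction sequence of `G` encoded by `ps`: the maximum red
degree appearing in any of its trigraphs. -/
noncomputable def seqWidth (G : Trigraph V) (ps : List (V × V)) : ℕ :=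
  ((List.range (ps.length + 1)).map (fun j => (stage G (ps.take j)).maxRedDeg)).foldr max 0

/-- The twin-width of a trigraph: the minimum width of a contraction sequence. -/
noncomputable def tww (G : Trigraph V) : ℕ :=
  sInf {t | ∃ ps, G.IsContractionSeq ps ∧ G.seqWidth ps ≤ t}

/-- Where the original vertex `x` currently lives after the contractions in `ps`. -/
noncomputable def collapse (ps : List (V × V)) (x : V) : V :=
  ps.foldl (fun y p => if y = p.2 then p.1 else y) x

/-- The bag of a vertex `u` after the contractions in `ps`: all original vertices of `G`
contracted into `u`. -/
noncomputable def bag (G : Trigraph V) (ps : List (V × V)) (u : V) : Finset V :=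
  G.verts.filter (fun x => collapse ps x = u)

/-- The induced subtrigraph on a vertex set `Q`. -/
noncomputable def induce (G : Trigraph V) (Q : Finset V) : Trigraph V where
  verts := G.verts ∩ Q
  black := G.black.filter (fun e => ∀ x ∈ e, x ∈ Q)
  red := G.red.filter (fun e => ∀ x ∈ e, x ∈ Q)
  black_nodiag := fun e he => G.black_nodiag e (Finset.mem_filter.1 he).1
  red_nodiag := fun e he => G.red_nodiag e (Finset.mem_filter.1 he).1
  black_support := fun e he x hx =>
    Finset.mem_inter.2 ⟨G.black_support e (Finset.mem_filter.1 he).1 x hx,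
      (Finset.mem_filter.1 he).2 x hx⟩
  red_support := fun e he x hx =>
    Finset.mem_inter.2 ⟨G.red_support e (Finset.mem_filter.1 he).1 x hx,
      (Finset.mem_filter.1 he).2 x hx⟩
  disj := Finset.disjoint_filter_filter G.disj

/-- The underlying simple graph of a trigraph (ignoring colors). -/
def toSimple (G : Trigraph V) : SimpleGraph V :=
  SimpleGraph.fromEdgeSet ↑(G.black ∪ G.red)

/-- A trigraph is connected if it is nonempty and all pairs of its vertices are joined by paths. -/
def Conn (G : Trigraph V) : Prop :=
  G.verts.Nonempty ∧ ∀ x ∈ G.verts, ∀ y ∈ G.verts, G.toSimple.Reachable x y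

/-- Distance from a vertex `x` to a set `A` of vertices. -/
noncomputable def distToSet (G : Trigraph V) (A : Finset V) (x : V) : ℕ :=
  sInf {d | ∃ a ∈ A, G.toSimple.dist x a = d}

end Trigraph

namespace Trigraph

variable {V : Type u}

/-- A dangling red path in `G`: a nonempty list of distinct vertices of `G`, with consecutive
vertices joined by red edges, in which every vertex has degree 2 in `G`. -/
def IsDanglingRedPath (G : Trigraph V) (p : List V) : Prop :=
  p ≠ [] ∧ p.Nodup ∧ p.Chain' G.RedAdj ∧ ∀ x ∈ p, x ∈ G.verts ∧ G.deg x = 2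

/-- `G` is a tidy `(H, 𝒫)`-graph (Definition 5): `G` is connected with `tww(G) ≥ 2`, `𝒫` is a
nonempty set of pairwise disjoint dangling red paths, `H` (given by its vertex set `HV`) and
the disjoint union `⊔𝒫` are disjoint induced subtrigraphs covering all of `G`, and every
vertex of `H` with a neighbor in `⊔𝒫` has black degree 0 and exactly that one neighbor
in `⊔𝒫`. -/
structure IsTidy (G : Trigraph V) (HV : Finset V) (P : Finset (List V)) : Prop where
  conn : G.Conn
  tww_ge : 2 ≤ G.tww
  Pne : P.Nonempty
  paths : ∀ p ∈ P, G.IsDanglingRedPath p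
  pathsDisj : ∀ p ∈ P, ∀ q ∈ P, p ≠ q → ∀ x ∈ p, x ∉ q
  Hsub : HV ⊆ G.verts
  Hdisj : ∀ p ∈ P, ∀ x ∈ p, x ∉ HV
  cover : ∀ x ∈ G.verts, x ∈ HV ∨ ∃ p ∈ P, x ∈ p
  pathsInduced : ∀ p ∈ P, ∀ x ∈ p, ∀ y ∈ p, G.Adj x y → ([x, y] <:+: p ∨ [y, x] <:+: p)
  noPathPathEdges : ∀ p ∈ P, ∀ q ∈ P, p ≠ q → ∀ x ∈ p, ∀ y ∈ q, ¬ G.Adj x y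
  boundary : ∀ u ∈ HV, ∀ v, (∃ p ∈ P, v ∈ p) → G.Adj u v →
    G.blackDeg u = 0 ∧ ∀ w, (∃ p ∈ P, w ∈ p) → G.Adj u w → w = v

/-- The part `H'` of a trigraph obtained from `G` by the contractions `ps`: the vertices
whose bag is contained in `HV`. -/
noncomputable def Hpart (G : Trigraph V) (HV : Finset V) (ps : List (V × V)) : Finset V :=
  (stage G ps).verts.filter (fun u => bag G ps u ⊆ HV)

/-- The vertex set of `F`: the vertices outside `H` at distance at most `2m` from `H`. -/
noncomputable def Fverts (G : Trigraph V) (HV : Finset V) (m : ℕ) : Finset V :=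
  (G.verts \ HV).filter (fun x => G.distToSet HV x ≤ 2 * m)

/-- The part `F'` of a trigraph obtained from `G` by the contractions `ps`: the vertices
whose bag is contained in `V(F)`. -/
noncomputable def Fpart (G : Trigraph V) (HV : Finset V) (m : ℕ) (ps : List (V × V)) :
    Finset V :=
  (stage G ps).verts.filter (fun u => bag G ps u ⊆ Fverts G HV m)

/-- The level of a vertex: the (common) distance from `H` in `G` of the vertices in its bag. -/
noncomputable def level (G : Trigraph V) (HV : Finset V) (ps : List (V × V)) (u : V) : ℕ :=
  sInf {d | ∃ x ∈ bag G ps u, G.distToSet HV x = d}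

/-- The connected component of `u` in the forest `F'`. -/
noncomputable def Fcomp (G : Trigraph V) (HV : Finset V) (m : ℕ) (ps : List (V × V)) (u : V) :
    Finset V :=
  (Fpart G HV m ps).filter
    (fun w => ((stage G ps).induce (Fpart G HV m ps)).toSimple.Reachable u w)

/-- The degree-3 vertices of the component of `u` in `F'`. -/
noncomputable def Fcomp3 (G : Trigraph V) (HV : Finset V) (m : ℕ) (ps : List (V × V)) (u : V) :
    Finset V :=
  (Fcomp G HV m ps u).filter (fun w => (stage G ps).deg w = 3)

/-- The trigraph reached from `G` by the contractions `ps` is `G`-tidy (Definition 7), for a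
tidy `(H, 𝒫)`-graph `G` with `m = |𝒫|`. -/
structure IsGTidy (G : Trigraph V) (HV : Finset V) (m : ℕ) (ps : List (V × V)) : Prop where
  valid : ValidSteps G ps
  basic : ∀ u ∈ (stage G ps).verts,
      u ∈ Hpart G HV ps ∨ u ∈ Fpart G HV m ps ∨ (bag G ps u).card = 1
  outs : ∀ u ∈ Hpart G HV ps,
      (((stage G ps).verts \ Hpart G HV ps).filter (fun v => (stage G ps).Adj u v)).card ≤ 1
  levels : ∀ u ∈ Fpart G HV m ps, ∀ x ∈ bag G ps u, ∀ y ∈ bag G ps u,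
      G.distToSet HV x = G.distToSet HV y
  forest : ((stage G ps).induce (Fpart G HV m ps)).toSimple.IsAcyclic
  deg_le : ∀ u ∈ Fpart G HV m ps, (stage G ps).deg u ≤ 3
  comp_cond : ∀ u ∈ Fpart G HV m ps,
      ∃ r ∈ Fcomp G HV m ps u, level G HV ps r = 1 ∧
        (∀ r' ∈ Fcomp G HV m ps u, level G HV ps r' = 1 → r' = r) ∧
        (∀ a ∈ Fcomp3 G HV m ps u, ∀ b ∈ Fcomp3 G HV m ps u,
          ((stage G ps).induce (Fcomp3 G HV m ps u)).toSimple.Reachable a b) ∧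
        (∀ w ∈ Fcomp3 G HV m ps u, level G HV ps w ≤ (bag G ps r).card - 1) ∧
        (Fcomp3 G HV m ps u = ∅ ∨ r ∈ Fcomp3 G HV m ps u)

end Trigraph

namespace Trigraph

variable {V : Type u}

/-! ### Adjacency and degrees -/

lemma RedAdj.symm {G : Trigraph V} {x y : V} (h : G.RedAdj x y) : G.RedAdj y x := by
  unfold RedAdj at *; rwa [Sym2.eq_swap]

lemma BlackAdj.symm {G : Trigraph V} {x y : V} (h : G.BlackAdj x y) : G.BlackAdj y x := by
  unfold BlackAdj at *; rwa [Sym2.eq_swap]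

lemma Adj.symm {G : Trigraph V} {x y : V} (h : G.Adj x y) : G.Adj y x :=
  h.imp BlackAdj.symm RedAdj.symm

lemma RedAdj.ne {G : Trigraph V} {x y : V} (h : G.RedAdj x y) : x ≠ y := by
  rintro rfl
  exact G.red_nodiag _ h rfl

lemma BlackAdj.ne {G : Trigraph V} {x y : V} (h : G.BlackAdj x y) : x ≠ y := by
  rintro rfl
  exact G.black_nodiag _ h rfl

lemma Adj.ne {G : Trigraph V} {x y : V} (h : G.Adj x y) : x ≠ y :=
  h.elim BlackAdj.ne RedAdj.ne

lemma RedAdj.left_mem {G : Trigraph V} {x y : V} (h : G.RedAdj x y) : x ∈ G.verts :=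
  G.red_support _ h x (Sym2.mem_mk_left x y)

lemma Adj.left_mem {G : Trigraph V} {x y : V} (h : G.Adj x y) : x ∈ G.verts :=
  h.elim (fun h => G.black_support _ h x (Sym2.mem_mk_left x y)) RedAdj.left_mem

lemma Adj.right_mem {G : Trigraph V} {x y : V} (h : G.Adj x y) : y ∈ G.verts :=
  h.symm.left_mem

lemma RedAdj.not_black {G : Trigraph V} {x y : V} (h : G.RedAdj x y) : ¬ G.BlackAdj x y :=
  fun hb => Finset.disjoint_left.1 G.disj hb h

lemma toSimple_adj {G : Trigraph V} {x y : V} : G.toSimple.Adj x y ↔ G.Adj x y := by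
  have : G.toSimple.Adj x y ↔ G.Adj x y ∧ x ≠ y := by
    simp [toSimple, Adj, BlackAdj, RedAdj, or_and_right]
  rw [this]
  exact and_iff_left_of_imp Adj.ne

lemma card_filter_mem_eq (E : Finset (Sym2 V)) (S : Finset V) (x : V) (p : V → Prop)
    (hp : ∀ y, p y ↔ s(x, y) ∈ E) (hS : ∀ y, p y → y ∈ S) :
    (E.filter (fun e => x ∈ e)).card = (S.filter p).card := by
  have : E.filter (fun e => x ∈ e) = (S.filter p).image (fun y => s(x, y)) := by
    ext e
    simp only [mem_filter, mem_image]
    constructor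
    · rintro ⟨he, hx⟩
      obtain ⟨y, rfl⟩ := hx
      exact ⟨y, ⟨hS y ((hp y).2 he), (hp y).2 he⟩, rfl⟩
    · rintro ⟨y, ⟨_, hy⟩, rfl⟩
      exact ⟨(hp y).1 hy, Sym2.mem_mk_left x y⟩
  rw [this, card_image_of_injective]
  intro a b hab
  exact Sym2.congr_right.1 hab

lemma redDeg_eq (G : Trigraph V) (x : V) :
    G.redDeg x = (G.verts.filter (fun y => G.RedAdj x y)).card :=
  card_filter_mem_eq G.red G.verts x _ (fun _ => Iff.rfl) fun _ h => h.symm.left_mem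

lemma blackDeg_eq (G : Trigraph V) (x : V) :
    G.blackDeg x = (G.verts.filter (fun y => G.BlackAdj x y)).card :=
  card_filter_mem_eq G.black G.verts x _ (fun _ => Iff.rfl) fun _ h => Adj.right_mem (Or.inl h)

lemma deg_eq (G : Trigraph V) (x : V) :
    G.deg x = (G.verts.filter (fun y => G.Adj x y)).card :=
  card_filter_mem_eq (G.black ∪ G.red) G.verts x _ (fun _ => mem_union.symm)
    fun _ h => h.right_mem

lemma redDeg_le_deg (G : Trigraph V) (x : V) : G.redDeg x ≤ G.deg x := by
  rw [redDeg_eq, deg_eq]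
  exact card_le_card (monotone_filter_right _ fun _ _ h => Or.inr h)

lemma redDeg_le_card {G : Trigraph V} {x : V} (S : Finset V) (h : ∀ y, G.RedAdj x y → y ∈ S) :
    G.redDeg x ≤ S.card := by
  rw [redDeg_eq]
  exact card_le_card fun y hy => h y (mem_filter.1 hy).2

lemma deg_le_card {G : Trigraph V} {x : V} (S : Finset V) (h : ∀ y, G.Adj x y → y ∈ S) :
    G.deg x ≤ S.card := by
  rw [deg_eq]
  exact card_le_card fun y hy => h y (mem_filter.1 hy).2

lemma card_le_deg {G : Trigraph V} {x : V} (S : Finset V) (h : ∀ y ∈ S, G.Adj x y) :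
    S.card ≤ G.deg x := by
  rw [deg_eq]
  exact card_le_card fun y hy => mem_filter.2 ⟨(h y hy).right_mem, h y hy⟩

lemma maxRedDeg_le {G : Trigraph V} {k : ℕ} : G.maxRedDeg ≤ k ↔ ∀ x ∈ G.verts, G.redDeg x ≤ k :=
  Finset.sup_le_iff

lemma ext_of_red {G G' : Trigraph V} (hv : G.verts = G'.verts) (hb : G.black = ∅)
    (hb' : G'.black = ∅) (h : ∀ x y, G.RedAdj x y ↔ G'.RedAdj x y) : G = G' := by
  have hr : G.red = G'.red := by
    ext e
    induction e with | _ x y => exact h x y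
  cases G; cases G'
  simp_all

lemma adj_iff_redAdj {G : Trigraph V} (hb : G.black = ∅) {x y : V} :
    G.Adj x y ↔ G.RedAdj x y := by
  simp [Adj, BlackAdj, hb]

/-! ### Induced subtrigraphs -/

lemma induce_redAdj {G : Trigraph V} {Q : Finset V} {x y : V} :
    (G.induce Q).RedAdj x y ↔ G.RedAdj x y ∧ x ∈ Q ∧ y ∈ Q := by
  simp [RedAdj, induce]

lemma induce_black {G : Trigraph V} {Q : Finset V} (hb : G.black = ∅) :
    (G.induce Q).black = ∅ := by
  simp [induce, hb]

lemma induce_verts {G : Trigraph V} {Q : Finset V} (hQ : Q ⊆ G.verts) :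
    (G.induce Q).verts = Q :=
  Finset.inter_eq_right.2 hQ

lemma redDeg_induce_le (G : Trigraph V) (Q : Finset V) (x : V) :
    (G.induce Q).redDeg x ≤ G.redDeg x := by
  rw [G.redDeg_eq]
  refine redDeg_le_card _ fun y hy => ?_
  have := (induce_redAdj.1 hy).1
  exact mem_filter.2 ⟨this.symm.left_mem, this⟩

lemma redDeg_induce_lt {G : Trigraph V} {Q : Finset V} {x z : V} (hz : G.RedAdj x z)
    (hzQ : z ∉ Q) : (G.induce Q).redDeg x < G.redDeg x := by
  rw [redDeg_eq, redDeg_eq]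
  refine card_lt_card ⟨fun y hy => ?_, fun hsub => ?_⟩
  · have := (induce_redAdj.1 (mem_filter.1 hy).2).1
    exact mem_filter.2 ⟨this.symm.left_mem, this⟩
  · have := hsub (mem_filter.2 ⟨hz.symm.left_mem, hz⟩)
    exact hzQ (induce_redAdj.1 (mem_filter.1 this).2).2.2

/-! ### Single contractions -/

/-- Contracting `v` into `u`, as a map on vertices. -/
noncomputable def merge (u v x : V) : V := if x = v then u else x

lemma merge_self (u v : V) : merge u v v = u := by simp [merge]

lemma merge_of_ne {u v x : V} (h : x ≠ v) : merge u v x = x := by simp [merge, h]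

section contract

variable {G : Trigraph V} {u v : V}

lemma contract_verts (h : u ≠ v) (hu : u ∈ G.verts) (hv : v ∈ G.verts) :
    (G.contract u v).verts = G.verts.erase v := by
  rw [contract, dif_pos ⟨h, hu, hv⟩]

lemma mk_mem_image_iff (S : Finset V) (u x y : V) :
    s(x, y) ∈ S.image (fun z => s(u, z)) ↔ (x = u ∧ y ∈ S) ∨ (y = u ∧ x ∈ S) := by
  simp only [mem_image, Sym2.eq_iff]
  grind

lemma contract_redAdj_of_mem (h : u ≠ v) (hu : u ∈ G.verts) (hv : v ∈ G.verts) {x y : V} :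
    (G.contract u v).RedAdj x y ↔
      (G.RedAdj x y ∧ u ≠ x ∧ u ≠ y ∧ v ≠ x ∧ v ≠ y) ∨
      (∃ z, z ≠ u ∧ z ≠ v ∧ ¬ (G.BlackAdj u z ∧ G.BlackAdj v z) ∧ (G.Adj u z ∨ G.Adj v z) ∧
        ((x = u ∧ y = z) ∨ (y = u ∧ x = z))) := by
  have hred : (G.contract u v).red = cRed G u v := by rw [contract, dif_pos ⟨h, hu, hv⟩]
  unfold RedAdj
  rw [hred, cRed, mem_union, mk_mem_image_iff]
  simp only [mem_filter, mem_erase, Sym2.mem_iff, not_or]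
  have key : ∀ z, ((z ≠ v ∧ z ∈ G.verts) ∧ z ≠ u ∧ ¬(s(u, z) ∈ G.black ∧ s(v, z) ∈ G.black) ∧
        (s(u, z) ∈ G.red ∨ s(v, z) ∈ G.red ∨
          ¬((s(u, z) ∈ G.black) ↔ (s(v, z) ∈ G.black)))) ↔
      (z ≠ u ∧ z ≠ v ∧ ¬ (G.BlackAdj u z ∧ G.BlackAdj v z) ∧ (G.Adj u z ∨ G.Adj v z)) := by
    intro z
    have hm : G.Adj u z ∨ G.Adj v z → z ∈ G.verts := fun hh => hh.elim Adj.right_mem Adj.right_mem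
    unfold Adj BlackAdj RedAdj at *
    tauto
  simp only [key]
  grind

lemma contract_blackAdj_of_mem (h : u ≠ v) (hu : u ∈ G.verts) (hv : v ∈ G.verts) {x y : V} :
    (G.contract u v).BlackAdj x y ↔
      (G.BlackAdj x y ∧ u ≠ x ∧ u ≠ y ∧ v ≠ x ∧ v ≠ y) ∨
      (∃ z, z ≠ u ∧ z ≠ v ∧ (G.BlackAdj u z ∧ G.BlackAdj v z) ∧
        ((x = u ∧ y = z) ∨ (y = u ∧ x = z))) := by
  have hbl : (G.contract u v).black = cBlack G u v := by rw [contract, dif_pos ⟨h, hu, hv⟩]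
  unfold BlackAdj
  rw [hbl, cBlack, mem_union, mk_mem_image_iff]
  simp only [mem_filter, mem_erase, Sym2.mem_iff, not_or]
  have hm : ∀ z, s(u, z) ∈ G.black → z ∈ G.verts := fun z hh => Adj.right_mem (Or.inl hh)
  grind

lemma contract_adj_iff (h : u ≠ v) (hu : u ∈ G.verts) (hv : v ∈ G.verts) {x y : V} :
    (G.contract u v).Adj x y ↔
      x ≠ y ∧ ∃ x₀ y₀, G.Adj x₀ y₀ ∧ merge u v x₀ = x ∧ merge u v y₀ = y := by
  have e : (G.contract u v).Adj x y ↔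
      (G.Adj x y ∧ u ≠ x ∧ u ≠ y ∧ v ≠ x ∧ v ≠ y) ∨
      (∃ z, z ≠ u ∧ z ≠ v ∧ (G.Adj u z ∨ G.Adj v z) ∧
        ((x = u ∧ y = z) ∨ (y = u ∧ x = z))) := by
    unfold Adj
    rw [contract_blackAdj_of_mem h hu hv, contract_redAdj_of_mem h hu hv]
    unfold Adj
    grind
  rw [e]
  constructor
  · rintro (⟨ha, h1, h2, h3, h4⟩ | ⟨z, hzu, hzv, ha, hxy⟩)
    · exact ⟨ha.ne, x, y, ha, merge_of_ne h3.symm, merge_of_ne h4.symm⟩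
    · rcases hxy with ⟨rfl, rfl⟩ | ⟨rfl, rfl⟩
      · refine ⟨hzu.symm, ?_⟩
        rcases ha with ha | ha
        · exact ⟨_, _, ha, merge_of_ne h, merge_of_ne hzv⟩
        · exact ⟨_, _, ha, merge_self _ _, merge_of_ne hzv⟩
      · refine ⟨hzu, ?_⟩
        rcases ha with ha | ha
        · exact ⟨_, _, ha.symm, merge_of_ne hzv, merge_of_ne h⟩
        · exact ⟨_, _, ha.symm, merge_of_ne hzv, merge_self _ _⟩
  · rintro ⟨hne, x₀, y₀, ha, rfl, rfl⟩
    have := ha.symm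
    unfold merge at *
    grind

lemma contract_black (hb : G.black = ∅) : (G.contract u v).black = ∅ := by
  rw [contract]
  split_ifs
  · simp [cBlack, hb]
  · exact hb

lemma contract_redAdj_iff (hb : G.black = ∅) (h : u ≠ v) (hu : u ∈ G.verts) (hv : v ∈ G.verts)
    {x y : V} :
    (G.contract u v).RedAdj x y ↔
      x ≠ y ∧ ∃ x₀ y₀, G.RedAdj x₀ y₀ ∧ merge u v x₀ = x ∧ merge u v y₀ = y := by
  simp only [← adj_iff_redAdj hb, ← adj_iff_redAdj (contract_black (u := u) (v := v) hb),
    contract_adj_iff h hu hv]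

end contract

/-! ### Partial contraction sequences as quotients -/

lemma collapse_cons (p : V × V) (ps : List (V × V)) (x : V) :
    collapse (p :: ps) x = collapse ps (merge p.1 p.2 x) := rfl

lemma stage_cons (G : Trigraph V) (p : V × V) (ps : List (V × V)) :
    stage G (p :: ps) = stage (G.contract p.1 p.2) ps := rfl

lemma stage_verts_subset {G : Trigraph V} {ps : List (V × V)} (hv : ValidSteps G ps) :
    (stage G ps).verts ⊆ G.verts := by
  induction ps generalizing G with
  | nil => exact fun _ h => h
  | cons p ps ih =>
    obtain ⟨h, h1, h2, hps⟩ := hv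
    exact (ih hps).trans (by rw [contract_verts h h1 h2]; exact erase_subset _ _)

lemma collapse_mem {G : Trigraph V} {ps : List (V × V)} (hv : ValidSteps G ps) {x : V}
    (hx : x ∈ G.verts) : collapse ps x ∈ (stage G ps).verts := by
  induction ps generalizing G x with
  | nil => exact hx
  | cons p ps ih =>
    obtain ⟨h, h1, h2, hps⟩ := hv
    refine ih hps ?_
    rw [contract_verts h h1 h2, mem_erase]
    change merge p.1 p.2 x ≠ p.2 ∧ merge p.1 p.2 x ∈ G.verts
    unfold merge
    split_ifs with hxp
    · exact ⟨h, h1⟩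
    · exact ⟨hxp, hx⟩

lemma collapse_eq_self {G : Trigraph V} {ps : List (V × V)} (hv : ValidSteps G ps) {u : V}
    (hu : u ∈ (stage G ps).verts) : collapse ps u = u := by
  induction ps generalizing G with
  | nil => rfl
  | cons p ps ih =>
    obtain ⟨h, h1, h2, hps⟩ := hv
    have : u ≠ p.2 := by
      have := stage_verts_subset hps hu
      rw [contract_verts h h1 h2] at this
      exact (mem_erase.1 this).1
    rw [collapse_cons, merge_of_ne this]
    exact ih hps hu

lemma stage_adj_iff {G : Trigraph V} {ps : List (V × V)} (hv : ValidSteps G ps) {x y : V} :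
    (stage G ps).Adj x y ↔
      x ≠ y ∧ ∃ x₀ y₀, G.Adj x₀ y₀ ∧ collapse ps x₀ = x ∧ collapse ps y₀ = y := by
  induction ps generalizing G with
  | nil =>
    constructor
    · intro h
      exact ⟨Adj.ne h, x, y, h, rfl, rfl⟩
    · rintro ⟨_, _, _, h, rfl, rfl⟩
      exact h
  | cons p ps ih =>
    obtain ⟨h, h1, h2, hps⟩ := hv
    rw [stage_cons, ih hps]
    refine and_congr_right fun hxy => ?_
    constructor
    · rintro ⟨x₁, y₁, ha, rfl, rfl⟩
      obtain ⟨_, x₀, y₀, ha₀, rfl, rfl⟩ := (contract_adj_iff h h1 h2).1 ha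
      exact ⟨x₀, y₀, ha₀, rfl, rfl⟩
    · rintro ⟨x₀, y₀, ha, rfl, rfl⟩
      refine ⟨merge p.1 p.2 x₀, merge p.1 p.2 y₀, ?_, rfl, rfl⟩
      refine (contract_adj_iff h h1 h2).2 ⟨fun he => hxy ?_, x₀, y₀, ha, rfl, rfl⟩
      simp only [collapse_cons, he]

lemma exists_blackAdj_of_stage {G : Trigraph V} {ps : List (V × V)} (hv : ValidSteps G ps)
    {x y : V} (hxy : (stage G ps).BlackAdj x y) :
    ∃ x₀ y₀, G.BlackAdj x₀ y₀ ∧ collapse ps x₀ = x ∧ collapse ps y₀ = y := by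
  induction ps generalizing G with
  | nil => exact ⟨x, y, hxy, rfl, rfl⟩
  | cons p ps ih =>
    obtain ⟨h, h1, h2, hps⟩ := hv
    obtain ⟨x₁, y₁, ha, rfl, rfl⟩ := ih hps hxy
    rcases (contract_blackAdj_of_mem h h1 h2).1 ha with ⟨ha, -, -, hx, hy⟩ | ⟨z, hz, hzv, hb, hxz⟩
    · exact ⟨x₁, y₁, ha, by rw [collapse_cons, merge_of_ne hx.symm],
        by rw [collapse_cons, merge_of_ne hy.symm]⟩
    · rcases hxz with ⟨rfl, rfl⟩ | ⟨rfl, rfl⟩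
      · exact ⟨_, _, hb.1, by rw [collapse_cons, merge_of_ne h],
          by rw [collapse_cons, merge_of_ne hzv]⟩
      · exact ⟨_, _, hb.1.symm, by rw [collapse_cons, merge_of_ne hzv],
          by rw [collapse_cons, merge_of_ne h]⟩

end Trigraph
namespace Trigraph

variable {V : Type u}

/-! ### Contraction sequences of bounded width -/

/-- `G` admits a contraction sequence of width at most `k`. -/
def HasSeqOfWidth (G : Trigraph V) (k : ℕ) : Prop :=
  ∃ qs : List (V × V), G.IsContractionSeq qs ∧ G.seqWidth qs ≤ k

lemma seqWidth_nil (G : Trigraph V) : G.seqWidth [] = G.maxRedDeg := by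
  simp [seqWidth, stage]

lemma seqWidth_cons (G : Trigraph V) (p : V × V) (ps : List (V × V)) :
    G.seqWidth (p :: ps) = max G.maxRedDeg ((G.contract p.1 p.2).seqWidth ps) := by
  unfold seqWidth
  rw [List.length_cons, List.range_succ_eq_map, List.map_cons, List.foldr_cons, List.map_map]
  rfl

lemma HasSeqOfWidth.of_card_eq_one {G : Trigraph V} {k : ℕ} (hk : G.maxRedDeg ≤ k)
    (h : G.verts.card = 1) : G.HasSeqOfWidth k :=
  ⟨[], ⟨trivial, h⟩, by rwa [seqWidth_nil]⟩

lemma HasSeqOfWidth.of_contract {G : Trigraph V} {k : ℕ} (hk : G.maxRedDeg ≤ k) {u v : V}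
    (h : u ≠ v) (hu : u ∈ G.verts) (hv : v ∈ G.verts) (hs : (G.contract u v).HasSeqOfWidth k) :
    G.HasSeqOfWidth k := by
  obtain ⟨qs, hqs, hw⟩ := hs
  exact ⟨(u, v) :: qs, ⟨⟨h, hu, hv, hqs.1⟩, hqs.2⟩, by
    rw [seqWidth_cons]; exact max_le hk hw⟩

lemma contract_leaf {G : Trigraph V} (hb : G.black = ∅) {v p : V} (hvp : G.RedAdj v p)
    (huniq : ∀ y, G.RedAdj v y → y = p) : G.contract p v = G.induce (G.verts.erase v) := by
  have hne := hvp.ne.symm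
  have hv := hvp.left_mem
  have hp := hvp.symm.left_mem
  refine ext_of_red ?_ (contract_black hb) (induce_black hb) fun x y => ?_
  · rw [contract_verts hne hp hv, induce_verts (erase_subset _ _)]
  · rw [contract_redAdj_iff hb hne hp hv, induce_redAdj, mem_erase, mem_erase]
    constructor
    · rintro ⟨hxy, x₀, y₀, ha, rfl, rfl⟩
      have h1 := ha.left_mem
      have h2 := ha.symm.left_mem
      have h3 := ha.symm
      unfold merge at *
      grind
    · rintro ⟨ha, ⟨hx, -⟩, hy, -⟩
      exact ⟨ha.ne, x, y, ha, merge_of_ne hx, merge_of_ne hy⟩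

lemma HasSeqOfWidth.of_leaf {G : Trigraph V} {k : ℕ} (hb : G.black = ∅) (hk : G.maxRedDeg ≤ k)
    {v p : V} (hvp : G.RedAdj v p) (huniq : ∀ y, G.RedAdj v y → y = p)
    (h : (G.induce (G.verts.erase v)).HasSeqOfWidth k) : G.HasSeqOfWidth k := by
  refine .of_contract hk hvp.ne.symm hvp.symm.left_mem hvp.left_mem ?_
  rwa [contract_leaf hb hvp huniq]

lemma induce_induce_erase {G : Trigraph V} (hb : G.black = ∅) {F : Finset V} (hF : F ⊆ G.verts)
    (v : V) : (G.induce F).induce ((G.induce F).verts.erase v) = G.induce (F.erase v) := by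
  rw [induce_verts hF]
  have hF' : F.erase v ⊆ F := erase_subset _ _
  refine ext_of_red ?_ (induce_black (induce_black hb)) (induce_black hb) fun x y => ?_
  · rw [induce_verts (hF'.trans hF), induce_verts]
    rwa [induce_verts hF]
  · simp only [induce_redAdj, mem_erase]
    tauto

lemma maxRedDeg_induce_le {G : Trigraph V} {F : Finset V} {k : ℕ}
    (hk : ∀ x ∈ F, G.redDeg x ≤ k) : (G.induce F).maxRedDeg ≤ k :=
  maxRedDeg_le.2 fun x hx => (redDeg_induce_le _ _ _).trans (hk x (mem_inter.1 hx).2)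

/-- A red tree can be contracted leaf by leaf without increasing its maximum degree. -/
lemma HasSeqOfWidth.of_tree {G : Trigraph V} (hb : G.black = ∅) {k : ℕ} {r : V} (d : V → ℕ)
    (F : Finset V) (hF : F ⊆ G.verts) (hr : r ∈ F) (hk : ∀ x ∈ F, G.redDeg x ≤ k)
    (hlow : ∀ w ∈ F, w ≠ r → ∃ y ∈ F, G.RedAdj w y ∧ d y < d w)
    (hac : (G.induce F).toSimple.IsAcyclic) : (G.induce F).HasSeqOfWidth k := by
  induction hn : F.card generalizing F with
  | zero => simp_all
  | succ n ih =>
    rcases (F.erase r).eq_empty_or_nonempty with he | he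
    · refine .of_card_eq_one (maxRedDeg_induce_le hk) ?_
      rw [induce_verts hF, ← card_erase_add_one hr, he, card_empty]
    obtain ⟨v, hv, hmax⟩ := exists_max_image (F.erase r) d he
    obtain ⟨hvr, hvF⟩ := mem_erase.1 hv
    obtain ⟨p, hpF, hvp, hdp⟩ := hlow v hvF hvr
    have hlow' : ∀ w ∈ F.erase v, w ≠ r → ∃ y ∈ F.erase v, G.RedAdj w y ∧ d y < d w := by
      intro w hw hwr
      obtain ⟨hwv, hwF⟩ := mem_erase.1 hw
      obtain ⟨y, hyF, hwy, hdy⟩ := hlow w hwF hwr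
      refine ⟨y, mem_erase.2 ⟨?_, hyF⟩, hwy, hdy⟩
      rintro rfl
      have := hmax w (mem_erase.2 ⟨hwr, hwF⟩)
      omega
    have hbF : (G.induce F).black = ∅ := induce_black hb
    have hsub : F.erase v ⊆ F := erase_subset _ _
    refine .of_leaf (v := v) (p := p) hbF (maxRedDeg_induce_le hk)
      (induce_redAdj.2 ⟨hvp, hvF, hpF⟩) ?_ ?_
    · intro y hy
      by_contra hyp
      obtain ⟨hvy, -, hyF⟩ := induce_redAdj.1 hy
      have hbr := SimpleGraph.isAcyclic_iff_forall_adj_isBridge.1 hac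
        (toSimple_adj.2 (Or.inr hy))
      refine SimpleGraph.isBridge_iff.1 hbr ?_
      set T := (G.induce F).toSimple.deleteEdges {s(v, y)}
      have hadj : ∀ a b, a ∈ F → b ∈ F → G.RedAdj a b → s(a, b) ≠ s(v, y) → T.Adj a b := by
        intro a b ha hb hab hne
        rw [SimpleGraph.deleteEdges_adj]
        exact ⟨toSimple_adj.2 (Or.inr (induce_redAdj.2 ⟨hab, ha, hb⟩)), hne⟩
      have hreach : ∀ n, ∀ w ∈ F.erase v, d w ≤ n → T.Reachable w r := by
        intro n
        induction n with
        | zero =>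
          intro w hw hdw
          by_cases hwr : w = r
          · rw [hwr]
          · obtain ⟨_, _, _, hlt⟩ := hlow' w hw hwr
            omega
        | succ n ihn =>
          intro w hw hdw
          by_cases hwr : w = r
          · rw [hwr]
          · obtain ⟨z, hz, hwz, hlt⟩ := hlow' w hw hwr
            refine SimpleGraph.Reachable.trans (SimpleGraph.Adj.reachable
              (hadj w z (hsub hw) (hsub hz) hwz ?_)) (ihn z hz (by omega))
            intro he
            have : v ∈ s(w, z) := he ▸ Sym2.mem_mk_left v y
            rcases Sym2.mem_iff.1 this with h | h
            · exact (mem_erase.1 hw).1 h.symm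
            · exact (mem_erase.1 hz).1 h.symm
      have h1 : T.Adj v p := hadj v p hvF hpF hvp fun he => hyp (Sym2.congr_right.1 he).symm
      exact h1.reachable.trans
        ((hreach _ p (mem_erase.2 ⟨hvp.ne.symm, hpF⟩) le_rfl).trans
          (hreach _ y (mem_erase.2 ⟨hvy.ne.symm, hyF⟩) le_rfl).symm)
    · rw [induce_induce_erase hb hF]
      refine ih _ (hsub.trans hF) (mem_erase.2 ⟨hvr.symm, hr⟩) (fun x hx => hk x (hsub hx))
        hlow' (hac.anti ?_) ?_
      · intro a b hab
        rw [toSimple_adj, adj_iff_redAdj (induce_black hb), induce_redAdj] at *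
        exact ⟨hab.1, hsub hab.2.1, hsub hab.2.2⟩
      · rw [card_erase_of_mem hvF, hn]
        rfl

/-! ### Folding a path onto the rest of the graph -/

/-- `u` and `v` are consecutive, in either order, in the list `x :: L ++ [b]`. -/
def Link (x : V) (L : List V) (b u v : V) : Prop :=
  match L with
  | [] => (u = x ∧ v = b) ∨ (u = b ∧ v = x)
  | q :: L => (u = x ∧ v = q) ∨ (u = q ∧ v = x) ∨ Link q L b u v

lemma Link.symm {x : V} {L : List V} {b u v : V} (h : Link x L b u v) : Link x L b v u := by
  induction L generalizing x with
  | nil => unfold Link at *; tauto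
  | cons q L ih =>
    rcases h with h | h | h
    · exact Or.inr (Or.inl h.symm)
    · exact Or.inl h.symm
    · exact Or.inr (Or.inr (ih h))

lemma Link.map {x : V} {L : List V} {b u v : V} (h : Link x L b u v) (f : V → V) :
    Link (f x) (L.map f) (f b) (f u) (f v) := by
  induction L generalizing x with
  | nil => rcases h with ⟨rfl, rfl⟩ | ⟨rfl, rfl⟩ <;> simp [Link]
  | cons q L ih =>
    rcases h with ⟨rfl, rfl⟩ | ⟨rfl, rfl⟩ | h
    · simp [Link]
    · simp [Link]
    · exact Or.inr (Or.inr (ih h))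

lemma Link.exists_preimage {x : V} {L : List V} {b u v : V} {f : V → V}
    (h : Link (f x) (L.map f) (f b) u v) : ∃ u₀ v₀, Link x L b u₀ v₀ ∧ f u₀ = u ∧ f v₀ = v := by
  induction L generalizing x with
  | nil =>
    rcases h with ⟨rfl, rfl⟩ | ⟨rfl, rfl⟩
    · exact ⟨x, b, Or.inl ⟨rfl, rfl⟩, rfl, rfl⟩
    · exact ⟨b, x, Or.inr ⟨rfl, rfl⟩, rfl, rfl⟩
  | cons q L ih =>
    rcases h with ⟨rfl, rfl⟩ | ⟨rfl, rfl⟩ | h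
    · exact ⟨x, q, Or.inl ⟨rfl, rfl⟩, rfl, rfl⟩
    · exact ⟨q, x, Or.inr (Or.inl ⟨rfl, rfl⟩), rfl, rfl⟩
    · obtain ⟨u₀, v₀, h, hu, hv⟩ := ih h
      exact ⟨u₀, v₀, Or.inr (Or.inr h), hu, hv⟩

lemma Link.mem {x : V} {L : List V} {b u v : V} (h : Link x L b u v) :
    u = x ∨ u ∈ L ∨ u = b := by
  induction L generalizing x with
  | nil => unfold Link at h; tauto
  | cons q L ih =>
    rcases h with ⟨rfl, rfl⟩ | ⟨rfl, rfl⟩ | h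
    · simp
    · simp
    · have := ih h
      simp only [List.mem_cons]
      tauto

lemma exists_link_finset (x : V) (L : List V) (b y : V) : ∃ S : Finset V,
    (∀ v, Link x L b y v → v ∈ S) ∧
      S.card ≤ (if y = x then 1 else 0) + (if y = b then 1 else 0) + 2 * L.count y := by
  induction L generalizing x with
  | nil =>
    refine ⟨(if y = x then {b} else ∅) ∪ (if y = b then {x} else ∅), ?_, ?_⟩
    · intro v hv
      rcases hv with ⟨rfl, rfl⟩ | ⟨rfl, rfl⟩ <;> simp
    · refine (card_union_le _ _).trans ?_
      split_ifs <;> simp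
  | cons q L ih =>
    obtain ⟨S, hS, hc⟩ := ih q
    refine ⟨(if y = x then {q} else ∅) ∪ ((if y = q then {x} else ∅) ∪ S), ?_, ?_⟩
    · intro v hv
      rcases hv with ⟨rfl, rfl⟩ | ⟨rfl, rfl⟩ | h
      · simp
      · simp
      · simp [hS v h]
    · refine (card_union_le _ _).trans ?_
      have h1 := card_union_le (if y = q then {x} else ∅) S
      have h2 : (if y = q then ({x} : Finset V) else ∅).card = if y = q then 1 else 0 := by
        split_ifs <;> simp
      have h3 : (if y = x then ({q} : Finset V) else ∅).card = if y = x then 1 else 0 := by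
        split_ifs <;> simp
      have h4 : (q :: L).count y = L.count y + if y = q then 1 else 0 := by
        rw [List.count_cons]
        simp only [beq_iff_eq, eq_comm (a := y)]
      rw [h3, h4]
      rw [h2] at h1
      split_ifs at * <;> omega

/-- `G` consists of `B` together with a red path with vertices `L` whose ends are attached to
the vertices `x` and `b` of `B`. -/
structure IsPathExtension (G B : Trigraph V) (x : V) (L : List V) (b : V) : Prop where
  black : G.black = ∅
  base_black : B.black = ∅
  verts : ∀ v, v ∈ G.verts ↔ v ∈ B.verts ∨ v ∈ L
  disj : ∀ v ∈ L, v ∉ B.verts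
  nodup : L.Nodup
  left_mem : x ∈ B.verts
  right_mem : b ∈ B.verts
  adj : ∀ u v, G.RedAdj u v ↔ u ≠ v ∧ (B.RedAdj u v ∨ Link x L b u v)

lemma IsPathExtension.maxRedDeg_le {G B : Trigraph V} {x b : V} {L : List V}
    (h : IsPathExtension G B x L b) {k : ℕ} (hk : B.maxRedDeg ≤ k)
    (hbk : B.redDeg b + 1 ≤ k) : G.maxRedDeg ≤ k + 1 := by
  refine Trigraph.maxRedDeg_le.2 fun y hy => ?_
  obtain ⟨S, hS, hc⟩ := exists_link_finset x L b y
  have hdeg : G.redDeg y ≤ B.redDeg y + S.card := by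
    rw [B.redDeg_eq]
    refine (redDeg_le_card (B.verts.filter (fun z => B.RedAdj y z) ∪ S) fun z hz => ?_).trans
      (card_union_le _ _)
    rcases ((h.adj y z).1 hz).2 with hz | hz
    · exact mem_union_left _ (mem_filter.2 ⟨hz.symm.left_mem, hz⟩)
    · exact mem_union_right _ (hS z hz)
  by_cases hyL : y ∈ L
  · have hyB := h.disj y hyL
    have hyx : y ≠ x := fun he => hyB (he ▸ h.left_mem)
    have hyb : y ≠ b := fun he => hyB (he ▸ h.right_mem)
    have h0 : B.redDeg y ≤ 0 := by
      refine redDeg_le_card ∅ fun z hz => absurd hz.left_mem hyB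
    have := List.nodup_iff_count_le_one.1 h.nodup y
    rw [if_neg hyx, if_neg hyb] at hc
    omega
  · have hyB : y ∈ B.verts := ((h.verts y).1 hy).resolve_right hyL
    have := Trigraph.maxRedDeg_le.1 hk y hyB
    rw [List.count_eq_zero_of_not_mem hyL] at hc
    by_cases hyb : y = b
    · subst hyb
      split_ifs at hc <;> omega
    · split_ifs at hc <;> omega

lemma IsPathExtension.contract {G B : Trigraph V} {x q b x' : V} {L : List V}
    (h : IsPathExtension G B x (q :: L) b) (hx' : x' = x ∨ B.RedAdj x x') :
    x' ∈ B.verts ∧ q ∈ G.verts ∧ IsPathExtension (G.contract x' q) B x' L b := by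
  have hxB : x' ∈ B.verts := by
    rcases hx' with rfl | hx'
    · exact h.left_mem
    · exact hx'.symm.left_mem
  have hqB : q ∉ B.verts := h.disj q (by simp)
  have hqG : q ∈ G.verts := (h.verts q).2 (by simp)
  have hxG : x' ∈ G.verts := (h.verts x').2 (Or.inl hxB)
  have hne : x' ≠ q := fun he => hqB (he ▸ hxB)
  have hqL : q ∉ L := (List.nodup_cons.1 h.nodup).1
  have hbq : b ≠ q := fun he => hqB (he ▸ h.right_mem)
  have hxq : x ≠ q := fun he => hqB (he ▸ h.left_mem)
  have hmapL : L.map (merge x' q) = L :=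
    (List.map_congr_left (g := id) fun y hy =>
      merge_of_ne fun he : y = q => hqL (he ▸ hy)).trans (List.map_id _)
  have hBne : ∀ y ∈ B.verts, merge x' q y = y := fun y hy =>
    merge_of_ne fun he => hqB (he ▸ hy)
  refine ⟨hxB, hqG, ⟨contract_black h.black, h.base_black, ?_, ?_, (List.nodup_cons.1 h.nodup).2,
    hxB, h.right_mem, ?_⟩⟩
  · intro v
    rw [contract_verts hne hxG hqG, mem_erase, h.verts, List.mem_cons]
    constructor
    · tauto
    · rintro (hv | hv)
      · exact ⟨fun he => hqB (he ▸ hv), Or.inl hv⟩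
      · exact ⟨fun he => hqL (he ▸ hv), Or.inr (Or.inr hv)⟩
  · exact fun v hv => h.disj v (List.mem_cons_of_mem _ hv)
  · intro u v
    rw [contract_redAdj_iff h.black hne hxG hqG]
    refine and_congr_right fun huv => ?_
    constructor
    · rintro ⟨u₀, v₀, ha, rfl, rfl⟩
      rcases ((h.adj _ _).1 ha).2 with hB | ⟨rfl, rfl⟩ | ⟨rfl, rfl⟩ | hl
      · rw [hBne _ hB.left_mem, hBne _ hB.symm.left_mem]
        exact Or.inl hB
      · rw [merge_self, merge_of_ne hxq] at *
        rcases hx' with rfl | hx'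
        · exact absurd rfl huv
        · exact Or.inl hx'
      · rw [merge_self, merge_of_ne hxq] at *
        rcases hx' with rfl | hx'
        · exact absurd rfl huv
        · exact Or.inl hx'.symm
      · have := hl.map (merge x' q)
        rw [merge_self, hmapL, merge_of_ne hbq] at this
        exact Or.inr this
    · rintro (hB | hl)
      · exact ⟨u, v, (h.adj _ _).2 ⟨huv, Or.inl hB⟩, hBne _ hB.left_mem, hBne _ hB.symm.left_mem⟩
      · have hl' : Link (merge x' q q) (L.map (merge x' q)) (merge x' q b) u v := by
          rwa [merge_self, hmapL, merge_of_ne hbq]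
        obtain ⟨u₀, v₀, hl₀, rfl, rfl⟩ := hl'.exists_preimage
        refine ⟨u₀, v₀, (h.adj _ _).2 ⟨fun he => huv (he ▸ rfl), ?_⟩, rfl, rfl⟩
        exact Or.inr (Or.inr (Or.inr hl₀))

lemma IsPathExtension.eq_base {G B : Trigraph V} {x b : V} (h : IsPathExtension G B x [] b)
    (hxb : x = b ∨ B.RedAdj x b) : G = B := by
  refine ext_of_red ?_ h.black h.base_black fun u v => ?_
  · ext v
    simp [h.verts]
  · rw [h.adj]
    constructor
    · rintro ⟨hne, hB | ⟨rfl, rfl⟩ | ⟨rfl, rfl⟩⟩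
      · exact hB
      · exact hxb.resolve_left hne
      · exact (hxb.resolve_left hne.symm).symm
    · exact fun hB => ⟨hB.ne, Or.inl hB⟩

/-- A long enough attached red path can be folded onto a walk joining its attachments. -/
lemma IsPathExtension.hasSeqOfWidth {G B : Trigraph V} {x b : V} {L : List V}
    (h : IsPathExtension G B x L b) {k : ℕ} (hk : B.maxRedDeg ≤ k)
    (hbk : B.redDeg b + 1 ≤ k) (w : B.toSimple.Walk x b) (hw : w.length ≤ L.length + 1)
    (hB : B.HasSeqOfWidth (k + 1)) : G.HasSeqOfWidth (k + 1) := by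
  induction L generalizing G x with
  | nil =>
    have : G = B := by
      refine h.eq_base ?_
      cases w with
      | nil => exact Or.inl rfl
      | cons ha w' =>
        rw [toSimple_adj, adj_iff_redAdj h.base_black] at ha
        cases w' with
        | nil => exact Or.inr ha
        | cons ha' w'' => simp at hw
    rwa [this]
  | cons q L ih =>
    have key : ∃ x', (x' = x ∨ B.RedAdj x x') ∧
        ∃ w' : B.toSimple.Walk x' b, w'.length ≤ L.length + 1 := by
      cases w with
      | nil => exact ⟨_, Or.inl rfl, SimpleGraph.Walk.nil, by simp⟩
      | cons ha w' =>
        rw [toSimple_adj, adj_iff_redAdj h.base_black] at ha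
        exact ⟨_, Or.inr ha, w', by simpa using hw⟩
    obtain ⟨x', hx', w', hw'⟩ := key
    obtain ⟨hxB, hqG, h'⟩ := h.contract hx'
    have hne : x' ≠ q := fun he => h.disj q (by simp) (he ▸ hxB)
    exact .of_contract (h.maxRedDeg_le hk hbk) hne ((h.verts x').2 (Or.inl hxB)) hqG
      (ih h' w' hw')

end Trigraph
namespace Trigraph

variable {V : Type u}

/-! ### Distances to `H` in a tidy graph -/

lemma distToSet_eq_of_rank {G : Trigraph V} {A : Finset V} (hG : G.Conn) (hA : A ⊆ G.verts)
    (f : V → ℕ) (hzero : ∀ x ∈ G.verts, f x = 0 ↔ x ∈ A)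
    (hlip : ∀ x y, G.Adj x y → f x ≤ f y + 1)
    (hdec : ∀ x ∈ G.verts, f x ≠ 0 → ∃ y, G.Adj x y ∧ f y < f x) {x : V} (hx : x ∈ G.verts) :
    G.distToSet A x = f x := by
  have hup : ∀ n, ∀ x ∈ G.verts, f x ≤ n →
      ∃ a ∈ A, ∃ w : G.toSimple.Walk x a, w.length ≤ f x := by
    intro n
    induction n with
    | zero =>
      intro x hx hf
      exact ⟨x, (hzero x hx).1 (by omega), .nil, by simp⟩
    | succ n ih =>
      intro x hx hf
      by_cases h0 : f x = 0
      · exact ⟨x, (hzero x hx).1 h0, .nil, by simp⟩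
      · obtain ⟨y, hxy, hlt⟩ := hdec x hx h0
        obtain ⟨a, ha, w, hw⟩ := ih y hxy.right_mem (by omega)
        exact ⟨a, ha, .cons (toSimple_adj.2 hxy) w, by rw [SimpleGraph.Walk.length_cons]; omega⟩
  have hwalk : ∀ x y (w : G.toSimple.Walk x y), f x ≤ f y + w.length := by
    intro x y w
    induction w with
    | nil => simp
    | cons h w ih =>
      have := hlip _ _ (toSimple_adj.1 h)
      rw [SimpleGraph.Walk.length_cons]
      omega
  obtain ⟨a, ha, w, hw⟩ := hup _ x hx le_rfl
  refine le_antisymm ?_ ?_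
  · have hmem : G.toSimple.dist x a ∈ {d | ∃ a ∈ A, G.toSimple.dist x a = d} := ⟨a, ha, rfl⟩
    exact (Nat.sInf_le hmem).trans ((SimpleGraph.dist_le w).trans hw)
  · refine le_csInf (s := {d | ∃ a ∈ A, G.toSimple.dist x a = d}) ⟨_, a, ha, rfl⟩ ?_
    rintro _ ⟨c, hc, rfl⟩
    obtain ⟨w, hw⟩ := (hG.2 x hx c (hA hc)).exists_walk_length_eq_dist
    have := hwalk x c w
    rw [(hzero c (hA hc)).2 hc] at this
    omega

/-- The distance of a vertex on one of the paths of `P` to the outside of that path; it is `0`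
outside the paths. -/
noncomputable def pathRank (P : Finset (List V)) (x : V) : ℕ :=
  if h : ∃ p ∈ P, x ∈ p then
    min (h.choose.idxOf x + 1) (h.choose.length - h.choose.idxOf x)
  else 0

lemma idx_unique {p : List V} (hp : p.Nodup) {i j : ℕ} {x : V} (hi : p[i]? = some x)
    (hj : p[j]? = some x) : i = j :=
  (List.getElem?_inj (List.getElem?_eq_some_iff.1 hi).1 hp).1 (hi.trans hj.symm)

namespace IsTidy

variable {G : Trigraph V} {HV : Finset V} {P : Finset (List V)}

lemma path_unique (ht : IsTidy G HV P) {p q : List V} (hp : p ∈ P) (hq : q ∈ P) {x : V}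
    (hxp : x ∈ p) (hxq : x ∈ q) : p = q := by
  by_contra hne
  exact ht.pathsDisj p hp q hq hne x hxp hxq

lemma nodup (ht : IsTidy G HV P) {p : List V} (hp : p ∈ P) : p.Nodup := (ht.paths p hp).2.1

lemma pathRank_eq (ht : IsTidy G HV P) {p : List V} (hp : p ∈ P) {i : ℕ} {x : V}
    (hi : p[i]? = some x) : pathRank P x = min (i + 1) (p.length - i) := by
  have hx : x ∈ p := List.mem_of_getElem? hi
  have h : ∃ p ∈ P, x ∈ p := ⟨p, hp, hx⟩
  have hc : h.choose = p := ht.path_unique h.choose_spec.1 hp h.choose_spec.2 hx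
  have hidx : p.idxOf x = i := by
    refine idx_unique (ht.nodup hp) ?_ hi
    rw [List.getElem?_eq_getElem (List.idxOf_lt_length_of_mem hx), List.getElem_idxOf]
  rw [pathRank, dif_pos h, hc, hidx]

lemma pathRank_eq_zero (ht : IsTidy G HV P) {x : V} (hx : x ∈ HV) : pathRank P x = 0 := by
  rw [pathRank, dif_neg]
  rintro ⟨p, hp, hxp⟩
  exact ht.Hdisj p hp x hxp hx

lemma mem_verts (ht : IsTidy G HV P) {p : List V} (hp : p ∈ P) {x : V} (hx : x ∈ p) :
    x ∈ G.verts := ((ht.paths p hp).2.2.2 x hx).1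

lemma path_redAdj (ht : IsTidy G HV P) {p : List V} (hp : p ∈ P) {i : ℕ} {x y : V}
    (hi : p[i]? = some x) (hj : p[i + 1]? = some y) : G.RedAdj x y := by
  obtain ⟨hi, rfl⟩ := List.getElem?_eq_some_iff.1 hi
  obtain ⟨hj', rfl⟩ := List.getElem?_eq_some_iff.1 hj
  exact List.isChain_iff_getElem.1 (ht.paths p hp).2.2.1 i hj'

lemma path_adj (ht : IsTidy G HV P) {p : List V} (hp : p ∈ P) {i : ℕ} {x y : V}
    (hi : p[i]? = some x) (hxy : G.Adj x y) :
    y ∈ HV ∨ ∃ j, p[j]? = some y ∧ (j = i + 1 ∨ i = j + 1) := by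
  have hx : x ∈ p := List.mem_of_getElem? hi
  rcases ht.cover y hxy.right_mem with hy | ⟨q, hq, hy⟩
  · exact Or.inl hy
  right
  have hpq : p = q := by
    by_contra hne
    exact ht.noPathPathEdges p hp q hq hne x hx y hy hxy
  subst hpq
  have hinf : ∀ a b : V, [a, b] <:+: p → ∃ k, p[k]? = some a ∧ p[k + 1]? = some b := by
    intro a b h
    obtain ⟨k, -, hk⟩ := List.infix_iff_getElem?.1 h
    have h0 := hk 0 (by simp)
    have h1 := hk 1 (by simp)
    exact ⟨k, by simpa using h0, by simpa [add_comm] using h1⟩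
  rcases ht.pathsInduced p hp x hx y hy hxy with h | h
  · obtain ⟨k, h1, h2⟩ := hinf _ _ h
    obtain rfl := idx_unique (ht.nodup hp) h1 hi
    exact ⟨_, h2, Or.inl rfl⟩
  · obtain ⟨k, h1, h2⟩ := hinf _ _ h
    exact ⟨k, h1, Or.inr (idx_unique (ht.nodup hp) hi h2)⟩

lemma exists_adj_of_end (ht : IsTidy G HV P) {p : List V} (hp : p ∈ P) {i : ℕ} {x : V}
    (hi : p[i]? = some x) (hend : i = 0 ∨ i + 1 = p.length) : ∃ y ∈ HV, G.Adj x y := by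
  by_contra hno
  push Not at hno
  have hdeg : G.deg x = 2 := ((ht.paths p hp).2.2.2 x (List.mem_of_getElem? hi)).2
  have : ∃ z, ∀ y, G.Adj x y → y = z := by
    have hj : ∀ y, G.Adj x y → ∃ j, p[j]? = some y ∧ (j = i + 1 ∨ i = j + 1) := fun y hxy =>
      (ht.path_adj hp hi hxy).resolve_left fun h => hno y h hxy
    by_cases hex : ∃ z, G.Adj x z
    · obtain ⟨z, hz⟩ := hex
      refine ⟨z, fun y hy => ?_⟩
      obtain ⟨j, hj1, hj2⟩ := hj z hz
      obtain ⟨k, hk1, hk2⟩ := hj y hy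
      have hl1 := (List.getElem?_eq_some_iff.1 hj1).1
      have hl2 := (List.getElem?_eq_some_iff.1 hk1).1
      have : j = k := by omega
      subst this
      rw [hj1] at hk1
      exact (Option.some.inj hk1).symm
    · exact ⟨x, fun y hy => absurd ⟨y, hy⟩ hex⟩
  obtain ⟨z, hz⟩ := this
  have := deg_le_card (G := G) (x := x) {z} fun y hy => by simp [hz y hy]
  rw [card_singleton] at this
  omega

lemma end_of_adj (ht : IsTidy G HV P) {p : List V} (hp : p ∈ P) {i : ℕ} {x y : V}
    (hi : p[i]? = some x) (hy : y ∈ HV) (hxy : G.Adj x y) : i = 0 ∨ i + 1 = p.length := by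
  by_contra hno
  push Not at hno
  have hil := (List.getElem?_eq_some_iff.1 hi).1
  have hdeg : G.deg x = 2 := ((ht.paths p hp).2.2.2 x (List.mem_of_getElem? hi)).2
  obtain ⟨k, rfl⟩ := Nat.exists_eq_succ_of_ne_zero hno.1
  have ha : p[k]? = some p[k] := List.getElem?_eq_getElem (by omega)
  have hb : p[k + 2]? = some (p[k + 2]'(by omega)) := List.getElem?_eq_getElem (by omega)
  have hne : p[k] ≠ p[k + 2]'(by omega) := fun he => by
    rw [← he] at hb
    have := idx_unique (ht.nodup hp) ha hb
    omega
  have hya : y ≠ p[k] := fun he => ht.Hdisj p hp _ (List.mem_of_getElem? ha) (he ▸ hy)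
  have hyb : y ≠ p[k + 2]'(by omega) := fun he =>
    ht.Hdisj p hp _ (List.mem_of_getElem? hb) (he ▸ hy)
  have := card_le_deg (G := G) (x := x) {y, p[k], p[k + 2]'(by omega)} fun z hz => by
    simp only [mem_insert, mem_singleton] at hz
    rcases hz with rfl | rfl | rfl
    · exact hxy
    · exact Or.inr (ht.path_redAdj hp ha hi).symm
    · exact Or.inr (ht.path_redAdj hp hi hb)
  rw [card_eq_three.2 ⟨_, _, _, hya, hyb, hne, rfl⟩] at this
  omega

lemma exists_idx (ht : IsTidy G HV P) {x : V} (hx : x ∈ G.verts) (hxH : x ∉ HV) :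
    ∃ p ∈ P, ∃ i : ℕ, p[i]? = some x := by
  obtain ⟨p, hp, hxp⟩ := (ht.cover x hx).resolve_left hxH
  exact ⟨p, hp, List.mem_iff_getElem?.1 hxp⟩

lemma pathRank_eq_zero_iff (ht : IsTidy G HV P) {x : V} (hx : x ∈ G.verts) :
    pathRank P x = 0 ↔ x ∈ HV := by
  refine ⟨fun h => ?_, ht.pathRank_eq_zero⟩
  by_contra hxH
  obtain ⟨p, hp, i, hi⟩ := ht.exists_idx hx hxH
  rw [ht.pathRank_eq hp hi] at h
  have := (List.getElem?_eq_some_iff.1 hi).1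
  omega

lemma pathRank_le (ht : IsTidy G HV P) {x y : V} (hxy : G.Adj x y) :
    pathRank P x ≤ pathRank P y + 1 := by
  by_cases hx : x ∈ HV
  · rw [ht.pathRank_eq_zero hx]
    omega
  obtain ⟨p, hp, i, hi⟩ := ht.exists_idx hxy.left_mem hx
  have hil := (List.getElem?_eq_some_iff.1 hi).1
  rw [ht.pathRank_eq hp hi]
  rcases ht.path_adj hp hi hxy with hy | ⟨j, hj, hij⟩
  · have := ht.end_of_adj hp hi hy hxy
    omega
  · rw [ht.pathRank_eq hp hj]
    omega

lemma exists_adj_pathRank (ht : IsTidy G HV P) {x : V} (hx : x ∈ G.verts)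
    (h0 : pathRank P x ≠ 0) : ∃ y, G.Adj x y ∧ pathRank P y + 1 = pathRank P x := by
  have hxH : x ∉ HV := fun h => h0 (ht.pathRank_eq_zero h)
  obtain ⟨p, hp, i, hi⟩ := ht.exists_idx hx hxH
  have hil := (List.getElem?_eq_some_iff.1 hi).1
  rw [ht.pathRank_eq hp hi]
  by_cases hend : i = 0 ∨ i + 1 = p.length
  · obtain ⟨y, hy, hxy⟩ := ht.exists_adj_of_end hp hi hend
    refine ⟨y, hxy, ?_⟩
    rw [ht.pathRank_eq_zero hy]
    omega
  · push Not at hend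
    obtain ⟨k, rfl⟩ := Nat.exists_eq_succ_of_ne_zero hend.1
    have ha : p[k]? = some p[k] := List.getElem?_eq_getElem (by omega)
    have hb : p[k + 2]? = some (p[k + 2]'(by omega)) := List.getElem?_eq_getElem (by omega)
    by_cases hc : k + 1 + 1 ≤ p.length - (k + 1)
    · refine ⟨_, Or.inr (ht.path_redAdj hp ha hi).symm, ?_⟩
      rw [ht.pathRank_eq hp ha]
      omega
    · refine ⟨_, Or.inr (ht.path_redAdj hp hi hb), ?_⟩
      rw [ht.pathRank_eq hp hb]
      omega

lemma distToSet_eq (ht : IsTidy G HV P) {x : V} (hx : x ∈ G.verts) :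
    G.distToSet HV x = pathRank P x := by
  refine distToSet_eq_of_rank ht.conn ht.Hsub _ (fun x hx => ht.pathRank_eq_zero_iff hx)
    (fun x y => ht.pathRank_le) (fun x hx h0 => ?_) hx
  obtain ⟨y, hxy, hy⟩ := ht.exists_adj_pathRank hx h0
  exact ⟨y, hxy, by omega⟩

lemma mem_Fverts_iff (ht : IsTidy G HV P) {m : ℕ} {x : V} :
    x ∈ Fverts G HV m ↔ x ∈ G.verts ∧ x ∉ HV ∧ pathRank P x ≤ 2 * m := by
  simp only [Fverts, mem_filter, mem_sdiff, and_assoc]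
  refine and_congr_right fun hx => ?_
  rw [ht.distToSet_eq hx]

lemma not_blackAdj (ht : IsTidy G HV P) {x y : V} (hx : x ∉ HV) : ¬ G.BlackAdj x y := by
  intro hb
  have hxy : G.Adj x y := Or.inl hb
  obtain ⟨p, hp, i, hi⟩ := ht.exists_idx hxy.left_mem hx
  rcases ht.path_adj hp hi hxy with hy | ⟨j, hj, rfl | rfl⟩
  · have h0 := (ht.boundary y hy x ⟨p, hp, List.mem_of_getElem? hi⟩ hxy.symm).1
    rw [blackDeg_eq, card_eq_zero] at h0
    have : x ∈ G.verts.filter (fun z => G.BlackAdj y z) :=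
      mem_filter.2 ⟨hxy.left_mem, hb.symm⟩
    rw [h0] at this
    simp at this
  · exact (ht.path_redAdj hp hi hj).not_black hb
  · exact (ht.path_redAdj hp hj hi).symm.not_black hb

end IsTidy

end Trigraph
namespace Trigraph

variable {V : Type u}

/-! ### The middle parts of the paths -/

/-- The vertices of the path `p` other than the first and the last `k` ones. -/
def middle (k : ℕ) (p : List V) : List V := (p.drop k).take (p.length - 2 * k)

lemma mem_middle_iff {k : ℕ} {p : List V} {x : V} :
    x ∈ middle k p ↔ ∃ j : ℕ, k ≤ j ∧ j + k < p.length ∧ p[j]? = some x := by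
  rw [middle, List.mem_iff_getElem?]
  simp only [List.getElem?_take, List.getElem?_drop]
  constructor
  · rintro ⟨i, hi⟩
    split_ifs at hi with hlt
    exact ⟨k + i, by omega, by omega, hi⟩
  · rintro ⟨j, h1, h2, h3⟩
    refine ⟨j - k, ?_⟩
    rw [if_pos (by omega), Nat.add_sub_cancel' h1, h3]

lemma length_middle {k : ℕ} {p : List V} (h : 2 * k ≤ p.length) :
    (middle k p).length = p.length - 2 * k := by
  simp only [middle, List.length_take, List.length_drop]
  omega

lemma link_take_drop_iff {p : List V} {i n : ℕ} {a b u v : V} (ha : p[i]? = some a)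
    (hb : p[i + 1 + n]? = some b) :
    Link a ((p.drop (i + 1)).take n) b u v ↔
      ∃ j, i ≤ j ∧ j ≤ i + n ∧
        ((p[j]? = some u ∧ p[j + 1]? = some v) ∨ (p[j]? = some v ∧ p[j + 1]? = some u)) := by
  induction n generalizing i a with
  | zero =>
    rw [List.take_zero, Link]
    constructor
    · rintro (⟨rfl, rfl⟩ | ⟨rfl, rfl⟩)
      · exact ⟨i, le_rfl, le_rfl, Or.inl ⟨ha, hb⟩⟩
      · exact ⟨i, le_rfl, le_rfl, Or.inr ⟨ha, hb⟩⟩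
    · rintro ⟨j, h1, h2, h⟩
      obtain rfl : j = i := by omega
      simp only [Nat.add_zero] at hb
      simp only [ha, hb, Option.some.injEq] at h
      tauto
  | succ n ih =>
    have hlt := (List.getElem?_eq_some_iff.1 hb).1
    have hq : p[i + 1]? = some (p[i + 1]'(by omega)) := List.getElem?_eq_getElem (by omega)
    have ih' := ih (i := i + 1) hq (by rw [← hb]; congr 1; omega)
    rw [List.drop_eq_getElem_cons (by omega), List.take_succ_cons, Link, ih']
    constructor
    · rintro (⟨rfl, rfl⟩ | ⟨rfl, rfl⟩ | ⟨j, h1, h2, h⟩)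
      · exact ⟨i, le_rfl, by omega, Or.inl ⟨ha, hq⟩⟩
      · exact ⟨i, le_rfl, by omega, Or.inr ⟨ha, hq⟩⟩
      · exact ⟨j, by omega, by omega, h⟩
    · rintro ⟨j, h1, h2, h⟩
      by_cases hj : j = i
      · subst hj
        simp only [ha, hq, Option.some.injEq] at h
        tauto
      · exact Or.inr (Or.inr ⟨j, by omega, by omega, h⟩)

lemma IsTidy.mem_middle_iff {G : Trigraph V} {HV : Finset V} {P : Finset (List V)}
    (ht : IsTidy G HV P) {p : List V} (hp : p ∈ P) {k : ℕ} {x : V} :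
    x ∈ middle k p ↔ x ∈ p ∧ k < pathRank P x := by
  rw [Trigraph.mem_middle_iff]
  constructor
  · rintro ⟨j, h1, h2, hj⟩
    refine ⟨List.mem_of_getElem? hj, ?_⟩
    rw [ht.pathRank_eq hp hj]
    omega
  · rintro ⟨hx, h⟩
    obtain ⟨j, hj⟩ := List.mem_iff_getElem?.1 hx
    rw [ht.pathRank_eq hp hj] at h
    exact ⟨j, by omega, by omega, hj⟩

/-! ### Structure of a `G`-tidy trigraph whose part `H'` is a single vertex -/

lemma mem_bag_iff {G : Trigraph V} {ps : List (V × V)} {u x : V} :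
    x ∈ bag G ps u ↔ x ∈ G.verts ∧ collapse ps x = u := by
  simp [bag]

namespace IsGTidy

variable {G : Trigraph V} {HV : Finset V} {P : Finset (List V)} {ps : List (V × V)} {h : V}

lemma mem_bag_self (hgt : IsGTidy G HV P.card ps) {u : V} (hu : u ∈ (stage G ps).verts) :
    u ∈ bag G ps u :=
  mem_bag_iff.2 ⟨stage_verts_subset hgt.valid hu, collapse_eq_self hgt.valid hu⟩

lemma mem_Hpart_of_mem (hgt : IsGTidy G HV P.card ps) (ht : IsTidy G HV P) {x : V}
    (hx : x ∈ HV) : collapse ps x ∈ Hpart G HV ps := by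
  have hxG := ht.Hsub hx
  have hxb : x ∈ bag G ps (collapse ps x) := mem_bag_iff.2 ⟨hxG, rfl⟩
  have hcN := collapse_mem hgt.valid hxG
  rcases hgt.basic _ hcN with hc | hc | hc
  · exact hc
  · exact absurd hx (ht.mem_Fverts_iff.1 ((mem_filter.1 hc).2 hxb)).2.1
  · refine mem_filter.2 ⟨hcN, fun y hy => ?_⟩
    rwa [card_le_one.1 hc.le y hy x hxb]

lemma mem_of_mem_Hpart {u x : V} (hx : x ∈ G.verts) (hu : u ∈ Hpart G HV ps)
    (hxu : collapse ps x = u) : x ∈ HV :=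
  (mem_filter.1 hu).2 (mem_bag_iff.2 ⟨hx, hxu⟩)

lemma mem_of_mem_Fpart (ht : IsTidy G HV P) {u x : V} (hx : x ∈ G.verts)
    (hu : u ∈ Fpart G HV P.card ps) (hxu : collapse ps x = u) :
    x ∉ HV ∧ pathRank P x ≤ 2 * P.card :=
  (ht.mem_Fverts_iff.1 ((mem_filter.1 hu).2 (mem_bag_iff.2 ⟨hx, hxu⟩))).2

lemma collapse_eq_of_rank (hgt : IsGTidy G HV P.card ps) (ht : IsTidy G HV P) {x y : V}
    (hx : x ∈ G.verts) (hr : 2 * P.card < pathRank P x) (hy : y ∈ G.verts)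
    (hxy : collapse ps y = collapse ps x) : y = x := by
  have hcN := collapse_mem hgt.valid hx
  rcases hgt.basic _ hcN with hc | hc | hc
  · have := ht.pathRank_eq_zero (mem_of_mem_Hpart hx hc rfl)
    omega
  · have := (mem_of_mem_Fpart ht hx hc rfl).2
    omega
  · exact card_le_one.1 hc.le y (mem_bag_iff.2 ⟨hy, hxy⟩) x (mem_bag_iff.2 ⟨hx, rfl⟩)

lemma collapse_eq_self_of_rank (hgt : IsGTidy G HV P.card ps) (ht : IsTidy G HV P) {x : V}
    (hx : x ∈ G.verts) (hr : 2 * P.card < pathRank P x) : collapse ps x = x := by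
  have hcN := collapse_mem hgt.valid hx
  exact hgt.collapse_eq_of_rank ht hx hr (stage_verts_subset hgt.valid hcN)
    (collapse_eq_self hgt.valid hcN)

lemma mem_Fpart_of_rank (hgt : IsGTidy G HV P.card ps) (ht : IsTidy G HV P) {x : V}
    (hx : x ∈ G.verts) (h0 : pathRank P x ≠ 0) (hr : pathRank P x ≤ 2 * P.card) :
    collapse ps x ∈ Fpart G HV P.card ps := by
  have hxH : x ∉ HV := fun h => h0 (ht.pathRank_eq_zero h)
  have hcN := collapse_mem hgt.valid hx
  rcases hgt.basic _ hcN with hc | hc | hc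
  · exact absurd (mem_of_mem_Hpart hx hc rfl) hxH
  · exact hc
  · refine mem_filter.2 ⟨hcN, fun y hy => ?_⟩
    rw [card_le_one.1 hc.le y hy x (mem_bag_iff.2 ⟨hx, rfl⟩)]
    exact ht.mem_Fverts_iff.2 ⟨hx, hxH, hr⟩

lemma pathRank_eq_of_mem_Fpart (hgt : IsGTidy G HV P.card ps) (ht : IsTidy G HV P) {u x : V}
    (hu : u ∈ Fpart G HV P.card ps) (hx : x ∈ G.verts) (hxu : collapse ps x = u) :
    pathRank P x = pathRank P u := by
  have huN := (mem_filter.1 hu).1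
  have := hgt.levels u hu x (mem_bag_iff.2 ⟨hx, hxu⟩) u (hgt.mem_bag_self huN)
  rwa [ht.distToSet_eq hx, ht.distToSet_eq (stage_verts_subset hgt.valid huN)] at this

lemma stage_black (hgt : IsGTidy G HV P.card ps) (ht : IsTidy G HV P)
    (h1 : Hpart G HV ps = {h}) : (stage G ps).black = ∅ := by
  refine eq_empty_of_forall_notMem fun e he => ?_
  induction e with | _ x y =>
  obtain ⟨x₀, y₀, hb, hx, hy⟩ := exists_blackAdj_of_stage hgt.valid he
  have hx₀ : x₀ ∈ HV := by
    by_contra hno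
    exact ht.not_blackAdj hno hb
  have hy₀ : y₀ ∈ HV := by
    by_contra hno
    exact ht.not_blackAdj hno hb.symm
  have h2 := hgt.mem_Hpart_of_mem ht hx₀
  have h3 := hgt.mem_Hpart_of_mem ht hy₀
  rw [h1, mem_singleton] at h2 h3
  exact BlackAdj.ne (G := stage G ps) he (by rw [← hx, ← hy, h2, h3])

lemma stage_redAdj_of_adj (hgt : IsGTidy G HV P.card ps) (ht : IsTidy G HV P)
    (h1 : Hpart G HV ps = {h}) {x y : V} (hxy : G.Adj x y)
    (hne : collapse ps x ≠ collapse ps y) :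
    (stage G ps).RedAdj (collapse ps x) (collapse ps y) :=
  (adj_iff_redAdj (hgt.stage_black ht h1)).1
    ((stage_adj_iff hgt.valid).2 ⟨hne, x, y, hxy, rfl, rfl⟩)

lemma stage_verts_cases (hgt : IsGTidy G HV P.card ps) (ht : IsTidy G HV P)
    (h1 : Hpart G HV ps = {h}) {u : V} (hu : u ∈ (stage G ps).verts) (huh : u ≠ h) :
    u ∈ Fpart G HV P.card ps ∨ ∃ p ∈ P, u ∈ middle (2 * P.card) p := by
  have huG := stage_verts_subset hgt.valid hu
  have hcu := collapse_eq_self hgt.valid hu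
  have huH : u ∉ HV := fun hmem => by
    have := hgt.mem_Hpart_of_mem ht hmem
    rw [h1, mem_singleton, hcu] at this
    exact huh this
  obtain ⟨p, hp, hup⟩ := (ht.cover u huG).resolve_left huH
  by_cases hr : pathRank P u ≤ 2 * P.card
  · left
    have h0 : pathRank P u ≠ 0 := fun h => huH ((ht.pathRank_eq_zero_iff huG).1 h)
    have := hgt.mem_Fpart_of_rank ht huG h0 hr
    rwa [hcu] at this
  · exact Or.inr ⟨p, hp, (ht.mem_middle_iff hp).2 ⟨hup, by omega⟩⟩

lemma redDeg_le_three (hgt : IsGTidy G HV P.card ps) (ht : IsTidy G HV P)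
    (h1 : Hpart G HV ps = {h}) {u : V} (hu : u ∈ (stage G ps).verts) :
    (stage G ps).redDeg u ≤ 3 := by
  by_cases huh : u = h
  · subst huh
    refine (redDeg_le_card _ fun y hy => ?_).trans
      ((hgt.outs u (by rw [h1]; exact mem_singleton_self u)).trans (by norm_num))
    rw [h1]
    exact mem_filter.2 ⟨mem_sdiff.2 ⟨hy.symm.left_mem, by simpa using hy.ne.symm⟩, Or.inr hy⟩
  rcases hgt.stage_verts_cases ht h1 hu huh with hF | ⟨p, hp, hup⟩
  · exact (redDeg_le_deg _ _).trans (hgt.deg_le u hF)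
  · obtain ⟨hup, hr⟩ := (ht.mem_middle_iff hp).1 hup
    have huG := ht.mem_verts hp hup
    have hcu := hgt.collapse_eq_self_of_rank ht huG hr
    refine (redDeg_le_card ((G.verts.filter (fun y => G.Adj u y)).image (collapse ps))
      fun y hy => ?_).trans (card_image_le.trans ?_)
    · obtain ⟨-, u₀, y₀, ha, hu₀, rfl⟩ := (stage_adj_iff hgt.valid).1 (Or.inr hy)
      obtain rfl := hgt.collapse_eq_of_rank ht huG hr ha.left_mem (hu₀.trans hcu.symm)
      exact mem_image_of_mem _ (mem_filter.2 ⟨ha.right_mem, ha⟩)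
    · rw [← deg_eq, ((ht.paths p hp).2.2.2 u hup).2]
      norm_num

/-- The part of a `G`-tidy trigraph formed by `F'` and the middle parts of the paths in `Q`. -/
noncomputable def part (G : Trigraph V) (HV : Finset V) (ps : List (V × V)) (m : ℕ)
    (Q : Finset (List V)) : Finset V :=
  Fpart G HV m ps ∪ Q.biUnion fun p => (middle (2 * m) p).toFinset

lemma mem_part_iff {m : ℕ} {Q : Finset (List V)} {u : V} : u ∈ part G HV ps m Q ↔
    u ∈ Fpart G HV m ps ∨ ∃ p ∈ Q, u ∈ middle (2 * m) p := by
  simp [part]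

lemma middle_subset (hgt : IsGTidy G HV P.card ps) (ht : IsTidy G HV P) {p : List V}
    (hp : p ∈ P) {u : V} (hu : u ∈ middle (2 * P.card) p) : u ∈ (stage G ps).verts := by
  obtain ⟨hup, hr⟩ := (ht.mem_middle_iff hp).1 hu
  have := collapse_mem hgt.valid (ht.mem_verts hp hup)
  rwa [hgt.collapse_eq_self_of_rank ht (ht.mem_verts hp hup) hr] at this

lemma part_subset (hgt : IsGTidy G HV P.card ps) (ht : IsTidy G HV P) {Q : Finset (List V)}
    (hQ : Q ⊆ P) : part G HV ps P.card Q ⊆ (stage G ps).verts := by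
  intro u hu
  rcases mem_part_iff.1 hu with hu | ⟨p, hp, hu⟩
  · exact (mem_filter.1 hu).1
  · exact hgt.middle_subset ht (hQ hp) hu

lemma middle_not_mem_part (hgt : IsGTidy G HV P.card ps) (ht : IsTidy G HV P)
    {Q : Finset (List V)} (hQ : Q ⊆ P) {p : List V} (hp : p ∈ P) (hpQ : p ∉ Q) {u : V}
    (hu : u ∈ middle (2 * P.card) p) : u ∉ part G HV ps P.card Q := by
  obtain ⟨hup, hr⟩ := (ht.mem_middle_iff hp).1 hu
  intro hmem
  rcases mem_part_iff.1 hmem with hF | ⟨q, hq, huq⟩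
  · have := (mem_of_mem_Fpart ht (ht.mem_verts hp hup) hF
      (hgt.collapse_eq_self_of_rank ht (ht.mem_verts hp hup) hr)).2
    omega
  · obtain rfl := ht.path_unique hp (hQ hq) hup ((ht.mem_middle_iff (hQ hq)).1 huq).1
    exact hpQ hq

lemma link_iff {p : List V} {k : ℕ} (hk : 1 ≤ k) (hl : 2 * k ≤ p.length) {a b u v : V}
    (ha : p[k - 1]? = some a) (hb : p[p.length - k]? = some b) :
    Link a (middle k p) b u v ↔
      ∃ j, k ≤ j + 1 ∧ j + k ≤ p.length - 1 ∧
        ((p[j]? = some u ∧ p[j + 1]? = some v) ∨ (p[j]? = some v ∧ p[j + 1]? = some u)) := by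
  have := link_take_drop_iff (p := p) (i := k - 1) (n := p.length - 2 * k) (u := u) (v := v) ha
    (b := b) (by rw [← hb]; congr 1; omega)
  rw [Nat.sub_add_cancel hk] at this
  rw [middle, this]
  refine exists_congr fun j => ?_
  constructor
  · rintro ⟨h1, h2, h⟩
    exact ⟨by omega, by omega, h⟩
  · rintro ⟨h1, h2, h⟩
    exact ⟨by omega, by omega, h⟩

lemma isPathExtension (hgt : IsGTidy G HV P.card ps) (ht : IsTidy G HV P)
    (h1 : Hpart G HV ps = {h}) {Q : Finset (List V)} (hQ : Q ⊆ P) {p : List V} (hp : p ∈ P)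
    (hpQ : p ∉ Q) (hl : 8 * P.card ≤ p.length) {a b : V}
    (ha : p[2 * P.card - 1]? = some a) (hb : p[p.length - 2 * P.card]? = some b) :
    IsPathExtension ((stage G ps).induce (part G HV ps P.card (insert p Q)))
      ((stage G ps).induce (part G HV ps P.card Q)) (collapse ps a) (middle (2 * P.card) p)
      (collapse ps b) := by
  have hm : 1 ≤ P.card := card_pos.2 ht.Pne
  have hblack := hgt.stage_black ht h1
  have hsub := hgt.part_subset ht hQ
  have hsub' := hgt.part_subset ht (insert_subset hp hQ)
  have hpart : ∀ u, u ∈ part G HV ps P.card (insert p Q) ↔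
      u ∈ part G HV ps P.card Q ∨ u ∈ middle (2 * P.card) p := by
    intro u
    simp only [mem_part_iff, mem_insert, exists_eq_or_imp]
    rw [or_assoc, or_comm (a := u ∈ middle (2 * #P) p)]
  have haF : collapse ps a ∈ Fpart G HV P.card ps := by
    refine hgt.mem_Fpart_of_rank ht (ht.mem_verts hp (List.mem_of_getElem? ha)) ?_ ?_ <;>
    · rw [ht.pathRank_eq hp ha]
      omega
  have hbF : collapse ps b ∈ Fpart G HV P.card ps := by
    refine hgt.mem_Fpart_of_rank ht (ht.mem_verts hp (List.mem_of_getElem? hb)) ?_ ?_ <;>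
    · rw [ht.pathRank_eq hp hb]
      omega
  have hcm : ∀ u ∈ middle (2 * P.card) p, collapse ps u = u := fun u hu => by
    obtain ⟨hup, hr⟩ := (ht.mem_middle_iff hp).1 hu
    exact hgt.collapse_eq_self_of_rank ht (ht.mem_verts hp hup) hr
  have hmap : (middle (2 * P.card) p).map (collapse ps) = middle (2 * P.card) p :=
    (List.map_congr_left (g := id) hcm).trans (List.map_id _)
  have hlink : ∀ u v, (stage G ps).RedAdj u v → u ∈ middle (2 * P.card) p →
      Link (collapse ps a) (middle (2 * P.card) p) (collapse ps b) u v := by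
    intro u v huv hu
    obtain ⟨hup, hr⟩ := (ht.mem_middle_iff hp).1 hu
    obtain ⟨-, u₀, v₀, ha₀, hu₀, rfl⟩ := (stage_adj_iff hgt.valid).1 (Or.inr huv)
    obtain rfl := hgt.collapse_eq_of_rank ht (ht.mem_verts hp hup) hr ha₀.left_mem
      (hu₀.trans (hcm u hu).symm)
    obtain ⟨i, hi1, hi2, hi⟩ := mem_middle_iff.1 hu
    have : Link a (middle (2 * P.card) p) b u₀ v₀ := by
      rw [link_iff (by omega) (by omega) ha hb]
      rcases ht.path_adj hp hi ha₀ with hv | ⟨j, hj, rfl | rfl⟩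
      · have := ht.pathRank_le ha₀
        rw [ht.pathRank_eq_zero hv] at this
        omega
      · exact ⟨i, by omega, by omega, Or.inl ⟨hi, hj⟩⟩
      · exact ⟨j, by omega, by omega, Or.inr ⟨hj, hi⟩⟩
    have := this.map (collapse ps)
    rwa [hmap, hcm u₀ hu] at this
  have hmem : ∀ u v, Link (collapse ps a) (middle (2 * P.card) p) (collapse ps b) u v →
      u ∈ part G HV ps P.card (insert p Q) := by
    intro u v huv
    rcases huv.mem with rfl | hu | rfl
    · exact mem_part_iff.2 (Or.inl haF)
    · exact (hpart u).2 (Or.inr hu)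
    · exact mem_part_iff.2 (Or.inl hbF)
  refine ⟨induce_black hblack, induce_black hblack, ?_, ?_, ?_, ?_, ?_, ?_⟩
  · rw [induce_verts hsub, induce_verts hsub']
    exact hpart
  · rw [induce_verts hsub]
    exact fun v hv => hgt.middle_not_mem_part ht hQ hp hpQ hv
  · exact ((ht.nodup hp).sublist (List.drop_sublist _ _)).sublist (List.take_sublist _ _)
  · rw [induce_verts hsub]
    exact mem_part_iff.2 (Or.inl haF)
  · rw [induce_verts hsub]
    exact mem_part_iff.2 (Or.inl hbF)
  · intro u v
    rw [induce_redAdj, induce_redAdj, hpart, hpart]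
    constructor
    · rintro ⟨huv, hu | hu, hv⟩
      · rcases hv with hv | hv
        · exact ⟨huv.ne, Or.inl ⟨huv, hu, hv⟩⟩
        · exact ⟨huv.ne, Or.inr (hlink v u huv.symm hv).symm⟩
      · exact ⟨huv.ne, Or.inr (hlink u v huv hu)⟩
    · rintro ⟨hne, ⟨huv, hu, hv⟩ | hl'⟩
      · exact ⟨huv, Or.inl hu, Or.inl hv⟩
      · refine ⟨?_, (hpart u).1 (hmem u v hl'), (hpart v).1 (hmem v u hl'.symm)⟩
        rw [← hmap] at hl'
        obtain ⟨u₀, v₀, hl₀, rfl, rfl⟩ := hl'.exists_preimage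
        obtain ⟨j, -, -, ⟨hj, hj'⟩ | ⟨hj, hj'⟩⟩ := (link_iff (by omega) (by omega) ha hb).1 hl₀
        · exact hgt.stage_redAdj_of_adj ht h1 (Or.inr (ht.path_redAdj hp hj hj')) hne
        · exact hgt.stage_redAdj_of_adj ht h1 (Or.inr (ht.path_redAdj hp hj hj').symm) hne

/-- Every vertex of `F'` other than the root has a neighbour in `F'` one level below. -/
lemma exists_lower (hgt : IsGTidy G HV P.card ps) (ht : IsTidy G HV P)
    (h1 : Hpart G HV ps = {h}) {u : V} (hu : u ∈ Fpart G HV P.card ps)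
    (hr : pathRank P u ≠ 1) : ∃ y ∈ Fpart G HV P.card ps, (stage G ps).RedAdj u y ∧
      pathRank P y + 1 = pathRank P u := by
  have huN := (mem_filter.1 hu).1
  have huG := stage_verts_subset hgt.valid huN
  have hcu := collapse_eq_self hgt.valid huN
  obtain ⟨huH, hur⟩ := mem_of_mem_Fpart ht huG hu hcu
  have h0 : pathRank P u ≠ 0 := fun h => huH ((ht.pathRank_eq_zero_iff huG).1 h)
  obtain ⟨y, huy, hy⟩ := ht.exists_adj_pathRank huG h0
  have hyF := hgt.mem_Fpart_of_rank ht huy.right_mem (by omega) (by omega)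
  have hyr := hgt.pathRank_eq_of_mem_Fpart ht hyF huy.right_mem rfl
  refine ⟨_, hyF, ?_, by omega⟩
  have := hgt.stage_redAdj_of_adj ht h1 huy (by
    rw [hcu]
    intro he
    rw [← he] at hyr
    omega)
  rwa [hcu] at this

/-- There is a unique vertex of level `1`, and it is adjacent to the vertex of `H'`. -/
lemma exists_root (hgt : IsGTidy G HV P.card ps) (ht : IsTidy G HV P)
    (h1 : Hpart G HV ps = {h}) : ∃ r ∈ Fpart G HV P.card ps, (stage G ps).RedAdj h r ∧
      (∀ y, (stage G ps).RedAdj h y → y = r) ∧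
      ∀ u ∈ Fpart G HV P.card ps, pathRank P u = 1 → u = r := by
  have hm : 1 ≤ P.card := card_pos.2 ht.Pne
  have hadj : ∀ x ∈ G.verts, pathRank P x = 1 → collapse ps x ∈ Fpart G HV P.card ps ∧
      (stage G ps).RedAdj h (collapse ps x) := by
    intro x hx hrx
    have hxF := hgt.mem_Fpart_of_rank ht hx (by omega) (by omega)
    refine ⟨hxF, ?_⟩
    obtain ⟨y, hxy, hy⟩ := ht.exists_adj_pathRank hx (by omega)
    have hyH := (ht.pathRank_eq_zero_iff hxy.right_mem).1 (by omega)
    have hyh := hgt.mem_Hpart_of_mem ht hyH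
    have hne : collapse ps y ≠ collapse ps x := fun he =>
      (mem_of_mem_Fpart ht hxy.right_mem hxF he).1 hyH
    have := hgt.stage_redAdj_of_adj ht h1 hxy.symm hne
    rw [h1, mem_singleton] at hyh
    rwa [hyh] at this
  have huniq : ∀ y z, (stage G ps).RedAdj h y → (stage G ps).RedAdj h z → y = z := by
    have hin : ∀ y, (stage G ps).RedAdj h y → y ∈ ((stage G ps).verts \ Hpart G HV ps).filter
        (fun v => (stage G ps).Adj h v) := fun y hy => by
      rw [h1]
      exact mem_filter.2 ⟨mem_sdiff.2 ⟨hy.symm.left_mem, by simpa using hy.ne.symm⟩, Or.inr hy⟩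
    intro y z hy hz
    exact card_le_one.1 (hgt.outs h (by rw [h1]; exact mem_singleton_self h)) y (hin y hy) z
      (hin z hz)
  obtain ⟨p, hp⟩ := ht.Pne
  have hlen : 0 < p.length := List.length_pos_iff.2 (ht.paths p hp).1
  have h0 : p[0]? = some p[0] := List.getElem?_eq_getElem hlen
  have hx := ht.mem_verts hp (List.mem_of_getElem? h0)
  obtain ⟨hrF, hr⟩ := hadj _ hx (by rw [ht.pathRank_eq hp h0]; omega)
  refine ⟨_, hrF, hr, fun y hy => huniq y _ hy hr, fun u hu hu1 => ?_⟩
  have huN := (mem_filter.1 hu).1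
  have := (hadj u (stage_verts_subset hgt.valid huN) hu1).2
  rw [collapse_eq_self hgt.valid huN] at this
  exact huniq u _ this hr

lemma exists_walk_root (hgt : IsGTidy G HV P.card ps) (ht : IsTidy G HV P)
    (h1 : Hpart G HV ps = {h}) {S : Finset V} (hS : Fpart G HV P.card ps ⊆ S) {r : V}
    (hr : ∀ u ∈ Fpart G HV P.card ps, pathRank P u = 1 → u = r) {u : V}
    (hu : u ∈ Fpart G HV P.card ps) :
    ∃ w : ((stage G ps).induce S).toSimple.Walk u r, w.length + 1 ≤ 2 * P.card := by
  have key : ∀ n, ∀ u ∈ Fpart G HV P.card ps, pathRank P u ≤ n + 1 →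
      ∃ w : ((stage G ps).induce S).toSimple.Walk u r, w.length ≤ n := by
    intro n
    induction n with
    | zero =>
      intro u hu hn
      by_cases hu1 : pathRank P u = 1
      · obtain rfl := hr u hu hu1
        exact ⟨.nil, by simp⟩
      · obtain ⟨y, hy, -, hlt⟩ := hgt.exists_lower ht h1 hu hu1
        have hyN := (mem_filter.1 hy).1
        have hyG := stage_verts_subset hgt.valid hyN
        have := (mem_of_mem_Fpart ht hyG hy (collapse_eq_self hgt.valid hyN)).1
        have : pathRank P y ≠ 0 := fun h => this ((ht.pathRank_eq_zero_iff hyG).1 h)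
        omega
    | succ n ih =>
      intro u hu hn
      by_cases hu1 : pathRank P u = 1
      · obtain rfl := hr u hu hu1
        exact ⟨.nil, by simp⟩
      · obtain ⟨y, hy, huy, hlt⟩ := hgt.exists_lower ht h1 hu hu1
        obtain ⟨w, hw⟩ := ih y hy (by omega)
        refine ⟨.cons (toSimple_adj.2 (Or.inr (induce_redAdj.2 ⟨huy, hS hu, hS hy⟩))) w, ?_⟩
        rw [SimpleGraph.Walk.length_cons]
        omega
  have hm : 1 ≤ P.card := card_pos.2 ht.Pne
  have huN := (mem_filter.1 hu).1
  have hur := (mem_of_mem_Fpart ht (stage_verts_subset hgt.valid huN) hu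
    (collapse_eq_self hgt.valid huN)).2
  obtain ⟨w, hw⟩ := key (2 * P.card - 1) u hu (by omega)
  exact ⟨w, by omega⟩

lemma hasSeqOfWidth_part (hgt : IsGTidy G HV P.card ps) (ht : IsTidy G HV P)
    (hlong : ∀ p ∈ P, 8 * P.card ≤ p.length) (h1 : Hpart G HV ps = {h})
    (Q : Finset (List V)) (hQ : Q ⊆ P) :
    ((stage G ps).induce (part G HV ps P.card Q)).HasSeqOfWidth 4 := by
  have hm : 1 ≤ P.card := card_pos.2 ht.Pne
  have hblack := hgt.stage_black ht h1
  obtain ⟨r, hrF, -, -, hr⟩ := hgt.exists_root ht h1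
  induction Q using Finset.induction_on with
  | empty =>
    have he : part G HV ps P.card ∅ = Fpart G HV P.card ps := by simp [part]
    rw [he]
    have hF : Fpart G HV P.card ps ⊆ (stage G ps).verts := filter_subset _ _
    refine .of_tree hblack (pathRank P) _ hF hrF
      (fun x hx => (hgt.redDeg_le_three ht h1 (hF hx)).trans (by norm_num)) ?_ hgt.forest
    intro w hw hwr
    obtain ⟨y, hy, hwy, hlt⟩ := hgt.exists_lower ht h1 hw fun hw1 => hwr (hr w hw hw1)
    exact ⟨y, hy, hwy, by omega⟩
  | insert p Q hpQ ih =>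
    have hp : p ∈ P := hQ (mem_insert_self p Q)
    have hQ' : Q ⊆ P := (subset_insert p Q).trans hQ
    have hl := hlong p hp
    have hsub := hgt.part_subset ht hQ'
    obtain ⟨a, ha⟩ : ∃ a, p[2 * P.card - 1]? = some a :=
      ⟨_, List.getElem?_eq_getElem (by omega)⟩
    obtain ⟨b, hb⟩ : ∃ b, p[p.length - 2 * P.card]? = some b :=
      ⟨_, List.getElem?_eq_getElem (by omega)⟩
    obtain ⟨z, hz⟩ : ∃ z, p[p.length - 2 * P.card - 1]? = some z :=
      ⟨_, List.getElem?_eq_getElem (by omega)⟩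
    have hFp : ∀ x i, p[i]? = some x → pathRank P x ≠ 0 → pathRank P x ≤ 2 * P.card →
        collapse ps x ∈ Fpart G HV P.card ps := fun x i hi =>
      hgt.mem_Fpart_of_rank ht (ht.mem_verts hp (List.mem_of_getElem? hi))
    have haF : collapse ps a ∈ Fpart G HV P.card ps := by
      refine hFp a _ ha ?_ ?_ <;>
      · rw [ht.pathRank_eq hp ha]
        omega
    have hbF : collapse ps b ∈ Fpart G HV P.card ps := by
      refine hFp b _ hb ?_ ?_ <;>
      · rw [ht.pathRank_eq hp hb]
        omega
    have hzm : z ∈ middle (2 * P.card) p := mem_middle_iff.2 ⟨_, by omega, by omega, hz⟩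
    have hzc : collapse ps z = z := by
      obtain ⟨hzp, hzr⟩ := (ht.mem_middle_iff hp).1 hzm
      exact hgt.collapse_eq_self_of_rank ht (ht.mem_verts hp hzp) hzr
    have hzS := hgt.middle_not_mem_part ht hQ' hp hpQ hzm
    have hFS : Fpart G HV P.card ps ⊆ part G HV ps P.card Q := subset_union_left
    have hzb : (stage G ps).RedAdj (collapse ps b) z := by
      have hadj : G.RedAdj z b := by
        refine ht.path_redAdj hp hz ?_
        rw [← hb]
        congr 1
        omega
      have hne : collapse ps b ≠ collapse ps z := fun he => hzS (by
        rw [← hzc, ← he]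
        exact hFS hbF)
      have := hgt.stage_redAdj_of_adj ht h1 (Or.inr hadj.symm) hne
      rwa [hzc] at this
    have hbdeg := redDeg_induce_lt hzb hzS
    have hb3 := hgt.redDeg_le_three ht h1 hzb.left_mem
    obtain ⟨wa, hwa⟩ := hgt.exists_walk_root ht h1 hFS hr haF
    obtain ⟨wb, hwb⟩ := hgt.exists_walk_root ht h1 hFS hr hbF
    refine (hgt.isPathExtension ht h1 hQ' hp hpQ hl ha hb).hasSeqOfWidth (k := 3)
      (maxRedDeg_induce_le fun x hx => hgt.redDeg_le_three ht h1 (hsub hx)) (by omega)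
      (wa.append wb.reverse) ?_ (ih hQ')
    rw [SimpleGraph.Walk.length_append, SimpleGraph.Walk.length_reverse,
      length_middle (by omega)]
    omega

lemma hasSeqOfWidth_four (hgt : IsGTidy G HV P.card ps) (ht : IsTidy G HV P)
    (hlong : ∀ p ∈ P, 8 * P.card ≤ p.length) (h1 : Hpart G HV ps = {h}) :
    (stage G ps).HasSeqOfWidth 4 := by
  obtain ⟨r, -, hhr, huniq, -⟩ := hgt.exists_root ht h1
  refine .of_leaf (hgt.stage_black ht h1)
    (maxRedDeg_le.2 fun x hx => (hgt.redDeg_le_three ht h1 hx).trans (by norm_num)) hhr huniq ?_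
  have he : (stage G ps).verts.erase h = part G HV ps P.card P := by
    have hh : h ∈ Hpart G HV ps := by rw [h1]; exact mem_singleton_self h
    have hhN := (mem_filter.1 hh).1
    have hhH : h ∈ HV := mem_of_mem_Hpart (stage_verts_subset hgt.valid hhN) hh
      (collapse_eq_self hgt.valid hhN)
    ext u
    rw [mem_erase]
    constructor
    · rintro ⟨huh, hu⟩
      exact mem_part_iff.2 (hgt.stage_verts_cases ht h1 hu huh)
    · intro hu
      refine ⟨?_, hgt.part_subset ht subset_rfl hu⟩
      rintro rfl
      rcases mem_part_iff.1 hu with hF | ⟨p, hp, hup⟩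
      · exact (mem_of_mem_Fpart ht (stage_verts_subset hgt.valid hhN) hF
          (collapse_eq_self hgt.valid hhN)).1 hhH
      · exact ht.Hdisj p hp _ ((ht.mem_middle_iff hp).1 hup).1 hhH
  rw [he]
  exact hgt.hasSeqOfWidth_part ht hlong h1 P subset_rfl

end IsGTidy

end Trigraph

open Trigraph

/-- **Contracting a `G`-tidy trigraph (Lemma 10).** Let `G` be a tidy `(H,𝒫)`-graph with
`m = |𝒫|` in which every path of `𝒫` has at least `8m` vertices. If `G'` is a `G`-tidy
trigraph whose part `H'` consists of a single vertex, then `G'` admits a contraction sequence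
of width at most 4. -/
theorem GTidy_contract_width_four {V : Type u} (G : Trigraph V) (HV : Finset V)
    (P : Finset (List V)) (ht : IsTidy G HV P)
    (hlong : ∀ p ∈ P, 8 * P.card ≤ p.length)
    (ps : List (V × V)) (hgt : IsGTidy G HV P.card ps)
    (h1 : (Hpart G HV ps).card = 1) :
    ∃ qs : List (V × V), (stage G ps).IsContractionSeq qs ∧ (stage G ps).seqWidth qs ≤ 4 := by
  obtain ⟨h, hh⟩ := Finset.card_eq_one.1 h1
  exact hgt.hasSeqOfWidth_four ht hlong hh
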